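/- For α > −1/2 let g(z) = (1−z)^α on the unit disk. Then the kernel of the Toeplitz operator T_{ḡ/g} is trivial for α ∈ (−1/2, 1/2], and for each positive integer n and α ∈ (n−1/2, n+1/2] the kernel has dimension n and equals (1−z)^{α−n} K_{zⁿ}, i.e. ker T_{ḡ/g} = { (1−z)^{α−n} p(z) : p a polynomial of degree at most n−1 }. -/

import Mathlib

open Complex MeasureTheory Filter Set

noncomputable section

/-! ### Basic framework: Hardy spaces on the unit disk via boundary values -/

/-- The open unit disk in the complex plane. -/
def unitDisk : Set ℂ := Metric.ball 0 1

/-- The point `e^{iθ}` of the unit circle. -/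
def uc (θ : ℝ) : ℂ := Complex.exp ((θ : ℂ) * Complex.I)

/-- Lebesgue measure on the parameter interval `(0, 2π]` of the unit circle. -/
def bMeasure : Measure ℝ := volume.restrict (Set.Ioc 0 (2 * Real.pi))

/-- Radial limit of `f` at the boundary point `w` (`|w| = 1`). -/
def radLim (f : ℂ → ℂ) (w : ℂ) : ℂ :=
  limUnder (nhdsWithin (1 : ℝ) (Set.Iio 1)) fun r : ℝ => f ((r : ℂ) * w)

/-- The boundary value function of `f` on the unit circle. -/
def bdry (f : ℂ → ℂ) (θ : ℝ) : ℂ := radLim f (uc θ)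

/-- Membership in the Hardy space `H²` of the unit disk. -/
def MemH2 (f : ℂ → ℂ) : Prop :=
  DifferentiableOn ℂ f unitDisk ∧
    ∃ C : ℝ, ∀ r ∈ Set.Ico (0 : ℝ) 1,
      (∫ θ in (0:ℝ)..(2 * Real.pi), ‖f ((r : ℂ) * uc θ)‖ ^ 2) ≤ C

/-- Membership in the Hardy space `H¹` of the unit disk. -/
def MemH1 (f : ℂ → ℂ) : Prop :=
  DifferentiableOn ℂ f unitDisk ∧
    ∃ C : ℝ, ∀ r ∈ Set.Ico (0 : ℝ) 1,
      (∫ θ in (0:ℝ)..(2 * Real.pi), ‖f ((r : ℂ) * uc θ)‖) ≤ C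

/-- Membership in `H^∞` (bounded holomorphic functions on the disk). -/
def MemHinf (f : ℂ → ℂ) : Prop :=
  DifferentiableOn ℂ f unitDisk ∧ ∃ C : ℝ, ∀ z ∈ unitDisk, ‖f z‖ ≤ C

/-- The `H²` (normalized boundary `L²`) inner product `⟨f, g⟩`. -/
def bInner (f g : ℂ → ℂ) : ℂ :=
  (1 / (2 * (Real.pi : ℂ))) *
    ∫ θ in (0:ℝ)..(2 * Real.pi), bdry f θ * (starRingEnd ℂ) (bdry g θ)

/-- The squared `H²` norm, computed on the boundary. -/
def bNormSq (f : ℂ → ℂ) : ℝ :=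
  (1 / (2 * Real.pi)) * ∫ θ in (0:ℝ)..(2 * Real.pi), ‖bdry f θ‖ ^ 2

/-- `f` is an inner function. -/
def IsInner (f : ℂ → ℂ) : Prop :=
  DifferentiableOn ℂ f unitDisk ∧ (∀ z ∈ unitDisk, ‖f z‖ ≤ 1) ∧
    ∀ᵐ θ ∂bMeasure, ‖bdry f θ‖ = 1

/-- `f` is an outer function: it is, up to a unimodular constant, the Herglotz
exponential of the Poisson integral of `log |f*|`. -/
def IsOuter (f : ℂ → ℂ) : Prop :=
  DifferentiableOn ℂ f unitDisk ∧ ∃ c : ℂ, ‖c‖ = 1 ∧ ∀ z ∈ unitDisk,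
    f z = c * Complex.exp ((1 / (2 * (Real.pi : ℂ))) *
      ∫ θ in (0:ℝ)..(2 * Real.pi),
        ((uc θ + z) / (uc θ - z)) * ((Real.log ‖bdry f θ‖ : ℝ) : ℂ))

/-- `b` is a nonextreme point of the closed unit ball of `H^∞`:
`log (1 - |b|)` is integrable on the circle. -/
def Nonextreme (b : ℂ → ℂ) : Prop :=
  DifferentiableOn ℂ b unitDisk ∧ (∀ z ∈ unitDisk, ‖b z‖ ≤ 1) ∧
    Integrable (fun θ => Real.log (1 - ‖bdry b θ‖)) bMeasure

/-- `(b, a)` is a pair: `b` nonextreme, `a` outer, `|a|² + |b|² = 1` a.e. on the circle. -/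
def IsPair (b a : ℂ → ℂ) : Prop :=
  Nonextreme b ∧ IsOuter a ∧
    ∀ᵐ θ ∂bMeasure, ‖bdry a θ‖ ^ 2 + ‖bdry b θ‖ ^ 2 = 1

/-- `(b, a)` is the pair associated with the outer function `f` of unit `H²` norm:
`f = a / (1 - b)`. -/
def PairAssoc (f b a : ℂ → ℂ) : Prop :=
  IsOuter f ∧ MemH2 f ∧ bNormSq f = 1 ∧ IsPair b a ∧
    ∀ z ∈ unitDisk, f z = a z / (1 - b z)

/-- The Herglotz measure `μ_λ` of `(1 + λ̄b)/(1 − λ̄b)` is absolutely continuous: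
the Herglotz representation holds with density `|a/(1 − λ̄b)|²` and no singular part. -/
def HerglotzAC (b a : ℂ → ℂ) (lam : ℂ) : Prop :=
  ∀ z ∈ unitDisk,
    (1 + (starRingEnd ℂ) lam * b z) / (1 - (starRingEnd ℂ) lam * b z) =
      (1 / (2 * (Real.pi : ℂ))) *
        (∫ θ in (0:ℝ)..(2 * Real.pi),
          ((1 + (uc θ)⁻¹ * z) / (1 - (uc θ)⁻¹ * z)) *
            ((‖bdry (fun w => a w / (1 - (starRingEnd ℂ) lam * b w)) θ‖ ^ 2 : ℝ) : ℂ)) +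
      Complex.I *
        ((((1 + (starRingEnd ℂ) lam * b 0) / (1 - (starRingEnd ℂ) lam * b 0)).im : ℝ) : ℂ)

/-- The pair `(b, a)` is special: the Herglotz measure of `(1+b)/(1−b)` is
absolutely continuous. -/
def SpecialPair (b a : ℂ → ℂ) : Prop := IsPair b a ∧ HerglotzAC b a 1

/-- `F ∈ H¹` is rigid: the only functions of `H¹` with the same argument a.e. on the
circle are the positive scalar multiples of `F`. -/
def Rigid (F : ℂ → ℂ) : Prop :=
  MemH1 F ∧ ∀ G : ℂ → ℂ, MemH1 G →
    (∀ᵐ θ ∂bMeasure, ∃ t : ℝ, 0 < t ∧ bdry G θ = (t : ℂ) * bdry F θ) →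
    ∃ c : ℝ, 0 < c ∧ ∀ z ∈ unitDisk, G z = (c : ℂ) * F z

/-- The Riesz (analytic) projection `P₊` of a boundary function, realized through the
Szegő integral: `(P₊u)(z) = (1/2π) ∫ u(θ) (1 − z e^{-iθ})⁻¹ dθ`. -/
def szProj (u : ℝ → ℂ) : ℂ → ℂ := fun z =>
  (1 / (2 * (Real.pi : ℂ))) *
    ∫ θ in (0:ℝ)..(2 * Real.pi), u θ * (1 - z * (uc θ)⁻¹)⁻¹

/-- The Toeplitz operator with boundary symbol `φ`: `T_φ h = P₊(φ · h*)`. -/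
def toeplitz (φ : ℝ → ℂ) (h : ℂ → ℂ) : ℂ → ℂ := szProj fun θ => φ θ * bdry h θ

/-- The kernel of the Toeplitz operator `T_φ`, as a subset of `H²`. -/
def toeplitzKer (φ : ℝ → ℂ) : Set (ℂ → ℂ) :=
  {h | MemH2 h ∧ ∀ z ∈ unitDisk, toeplitz φ h z = 0}

/-- The boundary symbol `ḡ` of a function `g` on the disk. -/
def conjBdry (g : ℂ → ℂ) : ℝ → ℂ := fun θ => (starRingEnd ℂ) (bdry g θ)

/-- The boundary symbol `ḡ/g`. -/
def symbQuot (g : ℂ → ℂ) : ℝ → ℂ := fun θ => (starRingEnd ℂ) (bdry g θ) / bdry g θ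

/-- The boundary symbol `Ī f̄ / f`. -/
def symbIf (I f : ℂ → ℂ) : ℝ → ℂ :=
  fun θ => (starRingEnd ℂ) (bdry I θ) * (starRingEnd ℂ) (bdry f θ) / bdry f θ

/-- The model space `K_I = H² ⊖ I H² = ker T_Ī` of an inner function `I`. -/
def modelSpace (I : ℂ → ℂ) : Set (ℂ → ℂ) := toeplitzKer (conjBdry I)

/-- The set `f·K_I`. -/
def fModel (f I : ℂ → ℂ) : Set (ℂ → ℂ) :=
  {g | ∃ h ∈ modelSpace I, ∀ z ∈ unitDisk, g z = f z * h z}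

/-- The orthogonal complement `ker T_{Ī f̄/f} ⊖ f·K_I` of `f·K_I` in the kernel of
`T_{Ī f̄/f}`, with respect to the `H²` inner product. -/
def kerPerp (I f : ℂ → ℂ) : Set (ℂ → ℂ) :=
  {h | h ∈ toeplitzKer (symbIf I f) ∧ ∀ g ∈ fModel f I, bInner h g = 0}

/-- `M(a) = T_a H² = a·H²` (for `a ∈ H^∞`), the range of `T_a`, as a set. -/
def rangeMa (a : ℂ → ℂ) : Set (ℂ → ℂ) :=
  {g | ∃ h, MemH2 h ∧ ∀ z ∈ unitDisk, g z = a z * h z}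

/-- Membership in the de Branges–Rovnyak space `H(b)` for nonextreme `b` with
pair `(b, a)`:  `h ∈ H(b)` iff `h ∈ H²` and `T_b̄ h = T_ā h⁺` for some `h⁺ ∈ H²`
(Sarason's characterization). -/
def MemHb (b a h : ℂ → ℂ) : Prop :=
  MemH2 h ∧ ∃ h' : ℂ → ℂ, MemH2 h' ∧
    ∀ z ∈ unitDisk, toeplitz (conjBdry b) h z = toeplitz (conjBdry a) h' z

/-- The function `h⁺ ∈ H²` with `T_b̄ h = T_ā h⁺` (unique when it exists, since `a`
is outer). -/
def plusFun (b a h : ℂ → ℂ) : ℂ → ℂ :=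
  Classical.epsilon fun h' : ℂ → ℂ => MemH2 h' ∧
    ∀ z ∈ unitDisk, toeplitz (conjBdry b) h z = toeplitz (conjBdry a) h' z

/-- The inner product of `H(b)`: `⟨h, g⟩_b = ⟨h, g⟩₂ + ⟨h⁺, g⁺⟩₂`. -/
def hbInner (b a h g : ℂ → ℂ) : ℂ :=
  bInner h g + bInner (plusFun b a h) (plusFun b a g)

/-- The squared norm of `H(b)`. -/
def hbNormSq (b a h : ℂ → ℂ) : ℝ := (hbInner b a h h).re

/-- The closure of a set `S` in the norm of `H(b)`. -/
def hbClosure (b a : ℂ → ℂ) (S : Set (ℂ → ℂ)) : Set (ℂ → ℂ) :=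
  {h | MemHb b a h ∧ ∀ ε : ℝ, 0 < ε → ∃ g ∈ S,
    hbNormSq b a (fun z => h z - g z) < ε}

/-- The orthogonal complement of `S` in `H(b)`. -/
def hbPerp (b a : ℂ → ℂ) (S : Set (ℂ → ℂ)) : Set (ℂ → ℂ) :=
  {h | MemHb b a h ∧ ∀ g ∈ S, hbInner b a h g = 0}

/-- A set of functions on the disk is a `k`-dimensional linear subspace. -/
def HasDimOn (S : Set (ℂ → ℂ)) (k : ℕ) : Prop :=
  ∃ g : Fin k → (ℂ → ℂ), (∀ j, g j ∈ S) ∧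
    (∀ c : Fin k → ℂ, (∀ z ∈ unitDisk, (∑ j, c j * g j z) = 0) → c = 0) ∧
    ∀ h ∈ S, ∃ c : Fin k → ℂ, ∀ z ∈ unitDisk, h z = ∑ j, c j * g j z

/-- The Szegő kernel `k_w(z) = (1 - w̄ z)⁻¹` of `H²`. -/
def szKernel (w z : ℂ) : ℂ := (1 - (starRingEnd ℂ) w * z)⁻¹

/-- The reproducing kernel of `H(b)` at an interior point `w ∈ 𝔻`. -/
def hbKernel (b : ℂ → ℂ) (w z : ℂ) : ℂ :=
  (1 - (starRingEnd ℂ) (b w) * b z) / (1 - (starRingEnd ℂ) w * z)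

/-- The boundary kernel of `H(b)` at a boundary point `z₀`, defined through the
nontangential limit `b(z₀) = radLim b z₀`. -/
def hbBoundaryKernel (b : ℂ → ℂ) (z₀ z : ℂ) : ℂ :=
  (1 - (starRingEnd ℂ) (radLim b z₀) * b z) / (1 - (starRingEnd ℂ) z₀ * z)

/-- `u` is a nontangential approach sequence to the boundary point `z₀`. -/
def NTApproach (u : ℕ → ℂ) (z₀ : ℂ) : Prop :=
  (∀ n, u n ∈ unitDisk) ∧ Filter.Tendsto u Filter.atTop (nhds z₀) ∧
    ∃ M : ℝ, ∀ n, ‖u n - z₀‖ ≤ M * (1 - ‖u n‖)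

/-- `b` has an angular derivative in the sense of Carathéodory at `z₀ ∈ ∂𝔻`. -/
def HasADC (b : ℂ → ℂ) (z₀ : ℂ) : Prop :=
  ‖radLim b z₀‖ = 1 ∧ ∃ L : ℂ, ∀ u : ℕ → ℂ, NTApproach u z₀ →
    Filter.Tendsto (fun n => b (u n)) Filter.atTop (nhds (radLim b z₀)) ∧
    Filter.Tendsto (fun n => (b (u n) - radLim b z₀) / (u n - z₀)) Filter.atTop (nhds L)

lemma uc_zpow (θ : ℝ) (k : ℤ) : uc θ ^ k = Complex.exp (((k : ℂ) * Complex.I) * θ) := by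
  rw [uc, ← Complex.exp_int_mul]; ring_nf

lemma norm_uc (θ : ℝ) : ‖uc θ‖ = 1 := Complex.norm_exp_ofReal_mul_I θ

lemma uc_ne_zero (θ : ℝ) : uc θ ≠ 0 := Complex.exp_ne_zero _

lemma continuous_uc : Continuous uc := by unfold uc; fun_prop

lemma conj_uc (θ : ℝ) : (starRingEnd ℂ) (uc θ) = (uc θ)⁻¹ :=
  (Complex.inv_eq_conj (norm_uc θ)).symm

lemma hasDerivAt_uc (θ : ℝ) : HasDerivAt uc (Complex.I * uc θ) θ := by
  have h := ((Complex.ofRealCLM.hasDerivAt (x := θ)).mul_const Complex.I).cexp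
  have e : uc = fun y : ℝ => Complex.exp (Complex.ofRealCLM y * Complex.I) := rfl
  rw [e]
  simpa [mul_comm] using h

lemma continuous_uc_zpow (k : ℤ) : Continuous fun θ => uc θ ^ k :=
  continuous_uc.zpow₀ k fun θ => Or.inl (uc_ne_zero θ)

lemma intervalIntegral_eq_bMeasure (f : ℝ → ℂ) :
    ∫ θ in (0 : ℝ)..(2 * Real.pi), f θ = ∫ θ, f θ ∂bMeasure :=
  intervalIntegral.integral_of_le Real.two_pi_pos.le

instance : IsFiniteMeasure bMeasure := by unfold bMeasure; infer_instance

lemma integral_uc_zpow (k : ℤ) :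
    ∫ θ, uc θ ^ k ∂bMeasure = if k = 0 then 2 * (Real.pi : ℂ) else 0 := by
  rw [← intervalIntegral_eq_bMeasure]
  split_ifs with hk
  · subst hk; simp
  · simp_rw [uc_zpow]
    rw [integral_exp_mul_complex (by simp [hk])]
    have h1 : (k : ℂ) * Complex.I * ((2 * Real.pi : ℝ) : ℂ) = k * (2 * Real.pi * Complex.I) := by
      push_cast; ring
    rw [h1, Complex.exp_int_mul_two_pi_mul_I]
    simp

lemma memLp_of_continuous {f : ℝ → ℂ} (hf : Continuous f) (p : ENNReal) :
    MemLp f p bMeasure := by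
  obtain ⟨C, hC⟩ := (isCompact_Icc (a := (0 : ℝ)) (b := 2 * Real.pi)).exists_bound_of_continuousOn
    hf.continuousOn
  refine MemLp.of_bound hf.aestronglyMeasurable C ?_
  exact (ae_restrict_iff' measurableSet_Ioc).2 (Eventually.of_forall fun θ hθ =>
    hC θ ⟨hθ.1.le, hθ.2⟩)

/-- The normalized exponentials in `L²` of the circle. -/
def expL2 (n : ℕ) : Lp ℂ 2 bMeasure :=
  (memLp_of_continuous (f := fun θ => ((Real.sqrt (2 * Real.pi) : ℝ) : ℂ)⁻¹ * uc θ ^ n)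
    (continuous_const.mul (continuous_uc.pow n)) 2).toLp _

lemma inner_toLp {f g : ℝ → ℂ} (hf : MemLp f 2 bMeasure) (hg : MemLp g 2 bMeasure) :
    inner ℂ (hf.toLp f) (hg.toLp g) = ∫ θ, g θ * (starRingEnd ℂ) (f θ) ∂bMeasure := by
  rw [L2.inner_def]
  refine integral_congr_ae ?_
  filter_upwards [hf.coeFn_toLp, hg.coeFn_toLp] with θ h1 h2
  rw [h1, h2]; rfl

lemma sqrt_two_pi_mul_self :
    ((Real.sqrt (2 * Real.pi) : ℝ) : ℂ) * ((Real.sqrt (2 * Real.pi) : ℝ) : ℂ) =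
      2 * (Real.pi : ℂ) := by
  rw [← Complex.ofReal_mul, Real.mul_self_sqrt Real.two_pi_pos.le]; push_cast; rfl

lemma sqrt_two_pi_ne_zero : ((Real.sqrt (2 * Real.pi) : ℝ) : ℂ) ≠ 0 :=
  Complex.ofReal_ne_zero.2 (Real.sqrt_pos.2 Real.two_pi_pos).ne'

lemma orthonormal_expL2 : Orthonormal ℂ expL2 := by
  rw [orthonormal_iff_ite]
  intro i j
  rw [expL2, expL2, inner_toLp]
  have h : ∀ θ : ℝ, (((Real.sqrt (2 * Real.pi) : ℝ) : ℂ)⁻¹ * uc θ ^ j) *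
      (starRingEnd ℂ) (((Real.sqrt (2 * Real.pi) : ℝ) : ℂ)⁻¹ * uc θ ^ i) =
      (2 * (Real.pi : ℂ))⁻¹ * uc θ ^ ((j : ℤ) - i) := by
    intro θ
    rw [← sqrt_two_pi_mul_self, zpow_sub₀ (uc_ne_zero θ)]
    simp only [map_mul, map_inv₀, Complex.conj_ofReal, map_pow, conj_uc, zpow_natCast, inv_pow]
    ring
  simp_rw [h]
  rw [integral_const_mul, integral_uc_zpow]
  have hp : (Real.pi : ℂ) ≠ 0 := Complex.ofReal_ne_zero.2 Real.pi_ne_zero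
  by_cases hij : i = j
  · subst hij; simp only [sub_self, if_true]; field_simp
  · rw [if_neg (by omega), if_neg hij, mul_zero]

/-- Riesz–Fischer: a square-summable sequence is the sequence of Fourier coefficients of an
`L²` function on the circle, whose Fourier series converges weakly. -/
lemma exists_memLp_hasSum_integral {a : ℕ → ℂ} (ha : Summable fun n => ‖a n‖ ^ 2) :
    ∃ f : ℝ → ℂ, MemLp f 2 bMeasure ∧ ∀ φ : ℝ → ℂ, MemLp φ 2 bMeasure →
      HasSum (fun n => a n * ∫ θ, φ θ * uc θ ^ n ∂bMeasure) (∫ θ, φ θ * f θ ∂bMeasure) := by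
  set s : ℂ := ((Real.sqrt (2 * Real.pi) : ℝ) : ℂ) with hs
  have h1 : Summable fun n => (a n * s) • expL2 n := by
    have h2 := (orthonormal_expL2.orthogonalFamily.summable_iff_norm_sq_summable
      (fun n => a n * s)).2 (by simpa [mul_pow] using ha.mul_right (‖s‖ ^ 2))
    simpa using h2
  refine ⟨_, Lp.memLp (∑' n, (a n * s) • expL2 n), fun φ hφ => ?_⟩
  have hφc : MemLp (fun θ => (starRingEnd ℂ) (φ θ)) 2 bMeasure := hφ.star
  have h3 := (innerSL ℂ (hφc.toLp _)).hasSum h1.hasSum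
  simp only [innerSL_apply_apply, inner_smul_right] at h3
  have e1 : ∀ n, a n * ∫ θ, φ θ * uc θ ^ n ∂bMeasure =
      a n * s * inner ℂ (hφc.toLp _) (expL2 n) := by
    intro n
    rw [expL2, inner_toLp, mul_assoc, ← integral_const_mul s]
    congr 2
    ext θ
    rw [Complex.conj_conj, ← hs, ← mul_assoc, ← mul_assoc, mul_inv_cancel₀ sqrt_two_pi_ne_zero,
      one_mul, mul_comm]
  have e2 : ∫ θ, φ θ * (∑' n, (a n * s) • expL2 n : Lp ℂ 2 bMeasure) θ ∂bMeasure =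
      inner ℂ (hφc.toLp _) (∑' n, (a n * s) • expL2 n) := by
    rw [L2.inner_def]
    refine integral_congr_ae ?_
    filter_upwards [hφc.coeFn_toLp] with θ h
    rw [h]
    change _ = _ * (starRingEnd ℂ) ((starRingEnd ℂ) (φ θ))
    rw [Complex.conj_conj, mul_comm]
  rw [e2, funext e1]
  exact h3

/-- The Cauchy formula for the derivative of a function holomorphic in the open unit disk and
continuous up to the boundary, with the kernel reflected in the unit circle. -/
lemma deriv_eq_integral_reflected {E : ℂ → ℂ} (hE : DiffContOnCl ℂ E (Metric.ball 0 1))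
    {z z' : ℂ} (hz : ‖z‖ < 1) (hz' : 1 < ‖z'‖) :
    deriv E z = (2 * (Real.pi : ℂ))⁻¹ * ∫ θ in (0 : ℝ)..(2 * Real.pi),
      uc θ * E (uc θ) * (((uc θ - z) ^ 2)⁻¹ - ((uc θ - z') ^ 2)⁻¹) := by
  have hzb : z ∈ Metric.ball (0 : ℂ) 1 := by simpa using hz
  have hcl : ContinuousOn E (Metric.closedBall 0 1) := by
    simpa [closure_ball (0 : ℂ) one_ne_zero] using hE.continuousOn
  have hsub : DiffContOnCl ℂ (dslope E z) (Metric.ball 0 1) := by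
    refine ⟨(Complex.differentiableOn_dslope (Metric.isOpen_ball.mem_nhds hzb)).2
      hE.differentiableOn, ?_⟩
    rw [closure_ball (0 : ℂ) one_ne_zero]
    exact (continuousOn_dslope (Metric.closedBall_mem_nhds_of_mem hzb)).2
      ⟨hcl, hE.differentiableAt Metric.isOpen_ball hzb⟩
  have h0 := hsub.two_pi_i_inv_smul_circleIntegral_sub_inv_smul hzb
  rw [dslope_same] at h0
  have hzs : ∀ w ∈ Metric.sphere (0 : ℂ) 1, w - z ≠ 0 := by
    intro w hw h
    rw [sub_eq_zero.1 h] at hw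
    simp only [mem_sphere_iff_norm, sub_zero] at hw
    linarith
  have hzs' : ∀ w ∈ Metric.closedBall (0 : ℂ) 1, w - z' ≠ 0 := by
    intro w hw h
    rw [sub_eq_zero.1 h] at hw
    simp only [mem_closedBall_iff_norm, sub_zero] at hw
    linarith
  have c1 : ContinuousOn (fun w : ℂ => ((w - z) ^ 2)⁻¹) (Metric.sphere 0 1) :=
    ContinuousOn.inv₀ (by fun_prop) fun w hw => pow_ne_zero 2 (hzs w hw)
  have c2 : ContinuousOn (fun w : ℂ => ((w - z') ^ 2)⁻¹) (Metric.closedBall 0 1) :=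
    ContinuousOn.inv₀ (by fun_prop) fun w hw => pow_ne_zero 2 (hzs' w hw)
  have h3 : ∮ w in C(0, 1), ((w - z') ^ 2)⁻¹ * E w = 0 := by
    refine DiffContOnCl.circleIntegral_eq_zero zero_le_one ⟨?_, ?_⟩
    · refine DifferentiableOn.mul (DifferentiableOn.inv (by fun_prop) fun w hw =>
        pow_ne_zero 2 (hzs' w (Metric.ball_subset_closedBall hw))) hE.differentiableOn
    · rw [closure_ball (0 : ℂ) one_ne_zero]
      exact c2.mul hcl
  have h4 : (∮ w in C(0, 1), ((w - z) ^ 2)⁻¹) = 0 := by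
    simpa using! circleIntegral.integral_sub_zpow_of_ne (by decide : (-2 : ℤ) ≠ -1) 0 z 1
  have hcs := hcl.mono Metric.sphere_subset_closedBall
  have i1 : CircleIntegrable (fun w => ((w - z) ^ 2)⁻¹ * E w) 0 1 :=
    (c1.mul hcs).circleIntegrable zero_le_one
  have i2 : CircleIntegrable (fun w => ((w - z) ^ 2)⁻¹ * E z) 0 1 :=
    (c1.mul continuousOn_const).circleIntegrable zero_le_one
  have i3 : CircleIntegrable (fun w => ((w - z') ^ 2)⁻¹ * E w) 0 1 :=
    ((c2.mono Metric.sphere_subset_closedBall).mul hcs).circleIntegrable zero_le_one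
  have h5 : (∮ w in C(0, 1), (w - z)⁻¹ • dslope E z w) =
      ∮ w in C(0, 1), (((w - z) ^ 2)⁻¹ * E w - ((w - z) ^ 2)⁻¹ * E z) := by
    refine circleIntegral.integral_congr zero_le_one fun w hw => ?_
    have := hzs w hw
    simp only [dslope_of_ne _ (sub_ne_zero.1 this), slope, vsub_eq_sub, smul_eq_mul]
    field_simp
  have h6 : (∮ w in C(0, 1), ((w - z) ^ 2)⁻¹ * E z) = 0 := by
    have := circleIntegral.integral_smul_const (fun w : ℂ => ((w - z) ^ 2)⁻¹) (E z) 0 1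
    simpa [h4] using this
  rw [circleIntegral.integral_sub i1 i2, h6, sub_zero] at h5
  have h7 : (∮ w in C(0, 1), (w - z)⁻¹ • dslope E z w) =
      ∮ w in C(0, 1), (((w - z) ^ 2)⁻¹ * E w - ((w - z') ^ 2)⁻¹ * E w) := by
    rw [circleIntegral.integral_sub i1 i3, h3, sub_zero, h5]
  rw [← h0, h7, circleIntegral]
  simp only [deriv_circleMap, smul_eq_mul]
  rw [← intervalIntegral.integral_const_mul, ← intervalIntegral.integral_const_mul]
  congr 1
  ext θ
  have hcm : circleMap 0 1 θ = uc θ := by simp [circleMap, uc]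
  rw [hcm]
  have : (Real.pi : ℂ) ≠ 0 := Complex.ofReal_ne_zero.2 Real.pi_ne_zero
  field_simp

lemma norm_sub_inv_smul_of_norm_one {w w₀ : ℂ} (hw : ‖w‖ = 1) (hw₀ : ‖w₀‖ = 1) {r : ℝ}
    (hr : 0 < r) : ‖w - (r : ℂ)⁻¹ * w₀‖ = r⁻¹ * ‖w - r * w₀‖ := by
  have hr' : (r : ℂ) ≠ 0 := Complex.ofReal_ne_zero.2 hr.ne'
  have h1 : w * (starRingEnd ℂ) w = 1 := by rw [Complex.mul_conj']; simp [hw]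
  have h2 : w₀ * (starRingEnd ℂ) w₀ = 1 := by rw [Complex.mul_conj']; simp [hw₀]
  have e : (starRingEnd ℂ) (w - r * w₀) * (w * w₀) = -(r * (w - (r : ℂ)⁻¹ * w₀)) := by
    simp only [map_sub, map_mul, Complex.conj_ofReal]
    field_simp
    linear_combination w₀ * h1 - r * w * h2
  have e2 := congrArg norm e
  simp only [norm_mul, hw, hw₀, norm_neg, RCLike.norm_conj, Complex.norm_real, mul_one,
    Real.norm_eq_abs, abs_of_pos hr] at e2
  rw [e2]
  field_simp

lemma reflected_kernel_bound {w w₀ : ℂ} (hw : ‖w‖ = 1) (hw₀ : ‖w₀‖ = 1) {r : ℝ}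
    (hr : 0 < r) (hr1 : r < 1) :
    ‖w - w₀‖ * ‖((w - r * w₀) ^ 2)⁻¹ - ((w - (r : ℂ)⁻¹ * w₀) ^ 2)⁻¹‖ ≤
      4 * ((1 - r ^ 2) / ‖w - r * w₀‖ ^ 2) := by
  have hX := norm_sub_inv_smul_of_norm_one hw hw₀ hr
  set X := w - (r : ℂ)⁻¹ * w₀ with hXd
  set Y := w - r * w₀ with hYd
  have hrw : ‖(r : ℂ) * w₀‖ = r := by simp [hw₀, abs_of_pos hr]
  have hY : 1 - r ≤ ‖Y‖ := by
    have := norm_sub_norm_le w (r * w₀)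
    rwa [hw, hrw] at this
  have hY0 : 0 < ‖Y‖ := by linarith
  have hX0 : 0 < ‖X‖ := by rw [hX]; positivity
  have hd : ‖w - w₀‖ ≤ 2 * ‖Y‖ := by
    have h1 : w - w₀ = Y - ((1 - r : ℝ) : ℂ) * w₀ := by rw [hYd]; push_cast; ring
    have h2 := norm_sub_le Y (((1 - r : ℝ) : ℂ) * w₀)
    rw [← h1, norm_mul, hw₀, Complex.norm_real, Real.norm_eq_abs, abs_of_pos (by linarith)] at h2
    linarith
  have hsub : ‖X - Y‖ = r⁻¹ - r := by
    have h1 : X - Y = ((r - r⁻¹ : ℝ) : ℂ) * w₀ := by rw [hYd, hXd]; push_cast; ring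
    have h2 : 1 < r⁻¹ := (one_lt_inv₀ hr).2 hr1
    rw [h1, norm_mul, hw₀, Complex.norm_real, Real.norm_eq_abs, abs_of_neg (by linarith)]
    ring
  have hadd : ‖X + Y‖ ≤ (r⁻¹ + 1) * ‖Y‖ := (norm_add_le _ _).trans (by rw [hX]; linarith)
  have hYne : Y ≠ 0 := norm_pos_iff.1 hY0
  have hXne : X ≠ 0 := norm_pos_iff.1 hX0
  have e : (Y ^ 2)⁻¹ - (X ^ 2)⁻¹ = (X - Y) * (X + Y) / (X ^ 2 * Y ^ 2) := by
    field_simp; ring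
  have hinv : 0 ≤ r⁻¹ - r := by rw [← hsub]; positivity
  rw [e, norm_div, norm_mul, norm_mul, norm_pow, norm_pow, hsub]
  calc ‖w - w₀‖ * ((r⁻¹ - r) * ‖X + Y‖ / (‖X‖ ^ 2 * ‖Y‖ ^ 2))
      ≤ (2 * ‖Y‖) * ((r⁻¹ - r) * ((r⁻¹ + 1) * ‖Y‖) / (‖X‖ ^ 2 * ‖Y‖ ^ 2)) := by gcongr
    _ = 2 * (1 + r) * ((1 - r ^ 2) / ‖Y‖ ^ 2) := by
        rw [hX]; field_simp
    _ ≤ 4 * ((1 - r ^ 2) / ‖Y‖ ^ 2) := by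
        have : 0 ≤ (1 - r ^ 2) / ‖Y‖ ^ 2 := div_nonneg (by nlinarith) (by positivity)
        nlinarith

lemma integral_poisson {z : ℂ} (hz : ‖z‖ < 1) :
    ∫ θ in (0 : ℝ)..(2 * Real.pi), (1 - ‖z‖ ^ 2) / ‖uc θ - z‖ ^ 2 = 2 * Real.pi := by
  have h := (diffContOnCl_const (c := (1 : ℂ)) (s := Metric.ball (0 : ℂ) 1)
    (𝕜 := ℂ)).circleAverage_poissonKernel_smul' (w := z) (by simpa using hz)
  have hcm : ∀ θ, circleMap 0 1 θ = uc θ := fun θ => by simp [circleMap, uc]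
  simp only [Real.circleAverage, hcm, sub_zero, norm_uc, one_pow, Complex.real_smul, mul_one] at h
  rw [intervalIntegral.integral_ofReal, ← Complex.ofReal_mul] at h
  have h2 := Complex.ofReal_eq_one.1 h
  field_simp at h2
  linarith

/-- If `E` vanishes to order more than one at a boundary point, its derivative is small on
the radius ending there. -/
lemma norm_deriv_le_of_boundary_bound {E : ℂ → ℂ} (hE : DiffContOnCl ℂ E (Metric.ball 0 1))
    {w₀ : ℂ} (hw₀ : ‖w₀‖ = 1) {ε M : ℝ} (hε : 0 ≤ ε)
    (hM : 0 ≤ M)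
    (hb : ∀ w, ‖w‖ = 1 → ‖E w‖ ≤ (ε + M * ‖w - w₀‖ ^ 2) * ‖w - w₀‖)
    {r : ℝ} (hr : 0 < r) (hr1 : r < 1) :
    ‖deriv E (r * w₀)‖ ≤ 4 * ε + 32 * M * (1 - r) := by
  have hrn : ‖(r : ℂ) * w₀‖ = r := by simp [hw₀, abs_of_pos hr]
  have hz : ‖(r : ℂ) * w₀‖ < 1 := by rwa [hrn]
  have hz' : 1 < ‖(r : ℂ)⁻¹ * w₀‖ := by
    simpa [hw₀, abs_of_pos hr] using (one_lt_inv₀ hr).2 hr1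
  have hYr : ∀ w : ℂ, ‖w‖ = 1 → 1 - r ≤ ‖w - r * w₀‖ := fun w hw => by
    have := norm_sub_norm_le w (r * w₀)
    rwa [hw, hrn] at this
  rw [deriv_eq_integral_reflected hE hz hz', norm_mul]
  have key : ∀ θ : ℝ, ‖uc θ * E (uc θ) * (((uc θ - r * w₀) ^ 2)⁻¹ -
      ((uc θ - (r : ℂ)⁻¹ * w₀) ^ 2)⁻¹)‖ ≤
      4 * ε * ((1 - r ^ 2) / ‖uc θ - r * w₀‖ ^ 2) + 32 * M * (1 - r) := by
    intro θ
    set w := uc θ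
    have hw : ‖w‖ = 1 := norm_uc θ
    have hY := hYr w hw
    have hY0 : 0 < ‖w - r * w₀‖ := by linarith
    have hk := reflected_kernel_bound hw hw₀ hr hr1
    have hd : ‖w - w₀‖ ≤ 2 * ‖w - r * w₀‖ := by
      have h2 := norm_sub_le (w - r * w₀) (((1 - r : ℝ) : ℂ) * w₀)
      have h1 : w - w₀ = w - r * w₀ - ((1 - r : ℝ) : ℂ) * w₀ := by push_cast; ring
      rw [← h1, norm_mul, hw₀, Complex.norm_real, Real.norm_eq_abs,
        abs_of_pos (by linarith)] at h2
      linarith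
    have hE' := hb w hw
    rw [norm_mul, norm_mul, hw, one_mul]
    set K := ‖((w - r * w₀) ^ 2)⁻¹ - ((w - (r : ℂ)⁻¹ * w₀) ^ 2)⁻¹‖
    set P := (1 - r ^ 2) / ‖w - r * w₀‖ ^ 2 with hP
    have hK : 0 ≤ K := norm_nonneg _
    have hP0 : 0 ≤ P := div_nonneg (by nlinarith) (by positivity)
    have hPd : ‖w - w₀‖ ^ 2 * P ≤ 8 * (1 - r) := by
      calc ‖w - w₀‖ ^ 2 * P ≤ (2 * ‖w - r * w₀‖) ^ 2 * P := by gcongr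
        _ = 4 * (1 - r ^ 2) := by rw [hP]; field_simp; ring
        _ ≤ 8 * (1 - r) := by nlinarith
    calc ‖E w‖ * K ≤ (ε + M * ‖w - w₀‖ ^ 2) * ‖w - w₀‖ * K := by gcongr
      _ = (ε + M * ‖w - w₀‖ ^ 2) * (‖w - w₀‖ * K) := by ring
      _ ≤ (ε + M * ‖w - w₀‖ ^ 2) * (4 * P) := by gcongr
      _ = 4 * ε * P + 4 * M * (‖w - w₀‖ ^ 2 * P) := by ring
      _ ≤ 4 * ε * P + 4 * M * (8 * (1 - r)) := by gcongr
      _ = 4 * ε * P + 32 * M * (1 - r) := by ring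
  have hcP : Continuous fun θ => (1 - r ^ 2) / ‖uc θ - r * w₀‖ ^ 2 := by
    refine continuous_const.div ((continuous_uc.sub continuous_const).norm.pow 2) fun θ => ?_
    have := hYr (uc θ) (norm_uc θ)
    have : 0 < ‖uc θ - r * w₀‖ := by linarith
    positivity
  have hinteg := intervalIntegral.norm_integral_le_of_norm_le
    (μ := volume) (a := 0) (b := 2 * Real.pi)
    Real.two_pi_pos.le (Eventually.of_forall fun θ _ => key θ)
    (((hcP.const_mul (4 * ε)).add continuous_const).intervalIntegrable _ _)
  have hP := integral_poisson hz
  rw [hrn] at hP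
  rw [intervalIntegral.integral_add ((hcP.const_mul (4 * ε)).intervalIntegrable _ _)
    (continuous_const.intervalIntegrable _ _), intervalIntegral.integral_const_mul, hP,
    intervalIntegral.integral_const, sub_zero, smul_eq_mul] at hinteg
  have hn : ‖(2 * (Real.pi : ℂ))⁻¹‖ = (2 * Real.pi)⁻¹ := by
    rw [norm_inv, norm_mul, Complex.norm_real, Real.norm_eq_abs, abs_of_pos Real.pi_pos]; simp
  rw [hn, inv_mul_le_iff₀ Real.two_pi_pos]
  linarith

/-- If a function holomorphic in the disk and continuous up to the boundary is differentiable
along the circle at a boundary point, then its derivative has a radial limit there. -/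
lemma tendsto_deriv_radial {H : ℂ → ℂ} (hH : DiffContOnCl ℂ H (Metric.ball 0 1)) {θ₀ : ℝ} {A : ℂ}
    (hd : HasDerivAt (fun θ => H (uc θ)) (Complex.I * uc θ₀ * A) θ₀) :
    Tendsto (fun r : ℝ => deriv H (r * uc θ₀)) (nhdsWithin 1 (Iio 1)) (nhds A) := by
  set w₀ := uc θ₀ with hw₀d
  have hw₀ : ‖w₀‖ = 1 := norm_uc θ₀
  set E : ℂ → ℂ := fun w => H w - H w₀ - A * (w - w₀) with hEd
  have hE : DiffContOnCl ℂ E (Metric.ball 0 1) := by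
    refine (hH.sub_const (H w₀)).sub ?_
    exact (Differentiable.diffContOnCl (by fun_prop))
  have hdE : HasDerivAt (fun θ => E (uc θ)) 0 θ₀ := by
    have h := (hd.sub_const (H w₀)).sub (((hasDerivAt_uc θ₀).sub_const w₀).const_mul A)
    rwa [← hw₀d, show Complex.I * w₀ * A - A * (Complex.I * w₀) = 0 by ring] at h
  have hE0 : E (uc θ₀) = 0 := by simp [hEd, ← hw₀d]
  have hcl : ContinuousOn E (Metric.closedBall 0 1) := by
    simpa [closure_ball (0 : ℂ) one_ne_zero] using hE.continuousOn
  obtain ⟨B, hB⟩ := (isCompact_closedBall (0 : ℂ) 1).exists_bound_of_continuousOn hcl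
  have hderiv : ∀ r : ℝ, 0 < r → r < 1 → deriv H (r * w₀) - A = deriv E (r * w₀) := by
    intro r hr hr1
    have hz : (r : ℂ) * w₀ ∈ Metric.ball (0 : ℂ) 1 := by simp [hw₀, abs_of_pos hr, hr1]
    have h1 := (hH.differentiableAt Metric.isOpen_ball hz).hasDerivAt
    have h2 := (h1.sub_const (H w₀)).sub (((hasDerivAt_id (r * w₀ : ℂ)).sub_const w₀).const_mul A)
    rw [mul_one] at h2
    exact h2.deriv.symm
  rw [Metric.tendsto_nhds]
  intro ε hε
  have hlit : ∀ᶠ θ in nhds θ₀, ‖E (uc θ)‖ ≤ (ε / 16) * |θ - θ₀| := by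
    have h := (hasDerivAt_iff_isLittleO.1 hdE).bound (show 0 < ε / 16 by positivity)
    simpa [hE0] using h
  obtain ⟨δ, hδ, hδb⟩ := Metric.eventually_nhds_iff.1 hlit
  set η := δ / 2 with hη
  have hη0 : 0 < η := by positivity
  have hB0 : 0 ≤ B := (norm_nonneg _).trans (hB 0 (by simp))
  have hbd : ∀ w, ‖w‖ = 1 → ‖E w‖ ≤ (ε / 8 + B / η ^ 3 * ‖w - w₀‖ ^ 2) * ‖w - w₀‖ := by
    intro w hw
    have hBw := hB w (by simp [hw])
    rcases lt_or_ge ‖w - w₀‖ η with hlt | hge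
    · have hw0 : w ≠ 0 := by rintro rfl; simp at hw
      have hw₀0 : w₀ ≠ 0 := uc_ne_zero θ₀
      have h1 := Complex.angle_le_mul_norm_sub hw hw₀
      rw [Complex.angle_eq_abs_arg hw0 hw₀0] at h1
      set t := (w / w₀).arg with ht
      have hwt : w = uc (θ₀ + t) := by
        have h2 := Complex.norm_mul_exp_arg_mul_I (w / w₀)
        rw [norm_div, hw, hw₀, ← ht] at h2
        have h3 : uc (θ₀ + t) = w₀ * Complex.exp (t * Complex.I) := by
          rw [hw₀d, uc, uc, ← Complex.exp_add]; push_cast; ring_nf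
        rw [h3]
        field_simp at h2
        simpa [mul_comm] using h2.symm
      have hpi : Real.pi / 2 ≤ 2 := by linarith [Real.pi_le_four]
      have h4 : |t| ≤ 2 * ‖w - w₀‖ := h1.trans (by gcongr)
      have h5 := hδb (y := θ₀ + t) (by rw [Real.dist_eq, add_sub_cancel_left]; linarith)
      rw [add_sub_cancel_left, ← hwt] at h5
      calc ‖E w‖ ≤ ε / 16 * |t| := h5
        _ ≤ ε / 16 * (2 * ‖w - w₀‖) := by gcongr
        _ = (ε / 8 + 0) * ‖w - w₀‖ := by ring
        _ ≤ _ := by gcongr; positivity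
    · calc ‖E w‖ ≤ B := hBw
        _ = B / η ^ 3 * η ^ 2 * η := by field_simp
        _ ≤ (0 + B / η ^ 3 * ‖w - w₀‖ ^ 2) * ‖w - w₀‖ := by rw [zero_add]; gcongr
        _ ≤ _ := by gcongr; positivity
  set M := B / η ^ 3
  have hM : 0 ≤ M := by positivity
  have hlim : Tendsto (fun r : ℝ => 4 * (ε / 8) + 32 * M * (1 - r)) (nhdsWithin 1 (Iio 1))
      (nhds (4 * (ε / 8) + 32 * M * (1 - 1))) :=
    (Continuous.tendsto (by fun_prop) 1).mono_left nhdsWithin_le_nhds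
  have hev := hlim.eventually_lt_const (show 4 * (ε / 8) + 32 * M * (1 - 1) < ε by linarith)
  filter_upwards [hev, Ioo_mem_nhdsLT (zero_lt_one (α := ℝ))] with r h1 h2
  rw [dist_eq_norm, hderiv r h2.1 h2.2]
  exact (norm_deriv_le_of_boundary_bound hE hw₀ (by positivity) hM hbd h2.1 h2.2).trans_lt h1

lemma mul_uc_mem_unitDisk {r : ℝ} (hr : 0 ≤ r) (hr1 : r < 1) (θ : ℝ) :
    (r : ℂ) * uc θ ∈ unitDisk := by
  simp [unitDisk, norm_uc, abs_of_nonneg hr, hr1]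

lemma continuous_comp_mul_uc {h : ℂ → ℂ} (hd : DifferentiableOn ℂ h unitDisk) {r : ℝ}
    (hr : 0 ≤ r) (hr1 : r < 1) : Continuous fun θ => h (r * uc θ) :=
  hd.continuousOn.comp_continuous (continuous_const.mul continuous_uc)
    (mul_uc_mem_unitDisk hr hr1)

lemma integral_circle_coeff {h : ℂ → ℂ} {a : ℕ → ℂ}
    (hs : ∀ z ∈ unitDisk, HasSum (fun n => a n * z ^ n) (h z)) {r : ℝ} (hr : 0 ≤ r) (hr1 : r < 1)
    (n : ℕ) :
    ∫ θ, h (r * uc θ) * uc θ ^ (-(n : ℤ)) ∂bMeasure = 2 * (Real.pi : ℂ) * (a n * (r : ℂ) ^ n) := by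
  have h1 : Summable fun m => ‖a m * (r : ℂ) ^ m‖ :=
    (hs r (by simp [unitDisk, abs_of_nonneg hr, hr1])).summable.norm
  set F : ℕ → ℝ → ℂ := fun m θ => a m * (r : ℂ) ^ m * uc θ ^ ((m : ℤ) - n) with hF
  have hFc : ∀ m, Continuous (F m) := fun m => continuous_const.mul (continuous_uc_zpow _)
  have hFn : ∀ m θ, ‖F m θ‖ = ‖a m * (r : ℂ) ^ m‖ := fun m θ => by
    simp [hF, norm_uc]
  have h2 := hasSum_integral_of_summable_integral_norm (μ := bMeasure) (F := F)
    (fun m => memLp_one_iff_integrable.1 (memLp_of_continuous (hFc m) 1)) (by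
      simp_rw [hFn, integral_const, smul_eq_mul]
      exact h1.mul_left _)
  have h3 : ∀ θ, ∑' m, F m θ = h (r * uc θ) * uc θ ^ (-(n : ℤ)) := by
    intro θ
    refine HasSum.tsum_eq ?_
    convert! (hs _ (mul_uc_mem_unitDisk hr hr1 θ)).mul_right (uc θ ^ (-(n : ℤ))) using 2 with m
    rw [hF, mul_pow]
    simp only
    rw [sub_eq_add_neg, zpow_add₀ (uc_ne_zero θ), zpow_natCast]
    ring
  simp_rw [h3] at h2
  have h4 : ∀ m, ∫ θ, F m θ ∂bMeasure = if m = n then 2 * (Real.pi : ℂ) * (a n * (r : ℂ) ^ n)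
      else 0 := by
    intro m
    rw [integral_const_mul, integral_uc_zpow]
    by_cases hmn : m = n
    · subst hmn; simp; ring
    · rw [if_neg (by omega), if_neg hmn, mul_zero]
  simp_rw [h4] at h2
  exact h2.unique (hasSum_ite_eq n _)

/-- The Taylor coefficients of an `H²` function are square-summable. -/
lemma MemH2.exists_coeff {h : ℂ → ℂ} (hh : MemH2 h) :
    ∃ a : ℕ → ℂ, Summable (fun n => ‖a n‖ ^ 2) ∧
      ∀ z ∈ unitDisk, HasSum (fun n => a n * z ^ n) (h z) := by
  obtain ⟨hd, C, hC⟩ := hh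
  set a : ℕ → ℂ := fun n => (n.factorial : ℂ)⁻¹ * iteratedDeriv n h 0 with ha
  have hs : ∀ z ∈ unitDisk, HasSum (fun n => a n * z ^ n) (h z) := by
    intro z hz
    convert! Complex.hasSum_taylorSeries_on_ball hd hz using 2 with n
    simp only [ha, smul_eq_mul, sub_zero]
    ring
  clear_value a
  refine ⟨a, ?_, hs⟩
  have key : ∀ N : ℕ, ∀ r ∈ Set.Ico (0 : ℝ) 1,
      ∑ n ∈ Finset.range N, 2 * Real.pi * (‖a n‖ ^ 2 * (r ^ n) ^ 2) ≤ C := by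
    intro N r hr
    have hc := memLp_of_continuous (continuous_comp_mul_uc hd hr.1 hr.2) 2
    have hB := orthonormal_expL2.sum_inner_products_le (s := Finset.range N) (x := hc.toLp _)
    have hn : ‖hc.toLp _‖ ^ 2 = ∫ θ in (0 : ℝ)..(2 * Real.pi), ‖h (r * uc θ)‖ ^ 2 := by
      have h1 := inner_self_eq_norm_sq_to_K (𝕜 := ℂ) (hc.toLp _)
      rw [inner_toLp] at h1
      simp_rw [Complex.mul_conj', ← Complex.ofReal_pow] at h1
      rw [integral_complex_ofReal] at h1
      rw [intervalIntegral.integral_of_le Real.two_pi_pos.le]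
      change _ = ∫ θ, ‖h (r * uc θ)‖ ^ 2 ∂bMeasure
      exact Complex.ofReal_injective (by simpa using h1.symm)
    rw [hn] at hB
    refine le_trans (le_of_eq ?_) (hB.trans (hC r hr))
    refine Finset.sum_congr rfl fun n _ => ?_
    have hi : inner ℂ (expL2 n) (hc.toLp _) =
        ((Real.sqrt (2 * Real.pi) : ℝ) : ℂ) * (a n * (r : ℂ) ^ n) := by
      rw [expL2, inner_toLp]
      have : ∀ θ, h (r * uc θ) *
          (starRingEnd ℂ) (((Real.sqrt (2 * Real.pi) : ℝ) : ℂ)⁻¹ * uc θ ^ n) =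
          ((Real.sqrt (2 * Real.pi) : ℝ) : ℂ)⁻¹ * (h (r * uc θ) * uc θ ^ (-(n : ℤ))) := by
        intro θ
        simp only [map_mul, map_inv₀, Complex.conj_ofReal, map_pow, conj_uc, zpow_neg,
          zpow_natCast, inv_pow]
        ring
      simp_rw [this]
      rw [integral_const_mul, integral_circle_coeff hs hr.1 hr.2, ← sqrt_two_pi_mul_self]
      have := sqrt_two_pi_ne_zero
      field_simp
    rw [hi, norm_mul, norm_mul, mul_pow, mul_pow, Complex.norm_real, Real.norm_eq_abs, sq_abs,
      Real.sq_sqrt Real.two_pi_pos.le, norm_pow, Complex.norm_real, Real.norm_eq_abs,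
      abs_of_nonneg hr.1]
  have key2 : ∀ N : ℕ, ∑ n ∈ Finset.range N, 2 * Real.pi * ‖a n‖ ^ 2 ≤ C := by
    intro N
    have hlim : Tendsto (fun r : ℝ => ∑ n ∈ Finset.range N,
        2 * Real.pi * (‖a n‖ ^ 2 * (r ^ n) ^ 2)) (nhdsWithin 1 (Iio 1))
        (nhds (∑ n ∈ Finset.range N, 2 * Real.pi * (‖a n‖ ^ 2 * ((1 : ℝ) ^ n) ^ 2))) :=
      (Continuous.tendsto (by fun_prop) 1).mono_left nhdsWithin_le_nhds
    simp only [one_pow, mul_one] at hlim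
    refine le_of_tendsto hlim ?_
    filter_upwards [Ioo_mem_nhdsLT (zero_lt_one (α := ℝ))] with r hr
    exact key N r ⟨hr.1.le, hr.2⟩
  have h5 := summable_of_sum_range_le (fun n => by positivity) key2
  exact (summable_mul_left_iff Real.two_pi_pos.ne').1 h5

lemma summable_norm_div_succ {a : ℕ → ℂ} (ha : Summable fun n => ‖a n‖ ^ 2) :
    Summable fun n : ℕ => ‖a n‖ / ((n : ℝ) + 1) := by
  have h1 : Summable fun n : ℕ => (1 / ((n : ℝ) + 1)) ^ 2 := by
    have := (summable_nat_add_iff 1).2 (Real.summable_one_div_nat_pow.2 one_lt_two)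
    simpa [div_pow] using this
  refine Summable.of_nonneg_of_le (fun n => by positivity) (fun n => ?_) (ha.add h1)
  have : ‖a n‖ / ((n : ℝ) + 1) = ‖a n‖ * (1 / ((n : ℝ) + 1)) := by ring
  rw [this]
  nlinarith [sq_nonneg (‖a n‖ - 1 / ((n : ℝ) + 1)), sq_nonneg (‖a n‖ + 1 / ((n : ℝ) + 1))]

lemma integral_uc_pow_Ioc (n : ℕ) (x : ℝ) :
    ∫ θ in (0 : ℝ)..x, Complex.I * uc θ * uc θ ^ n = (uc x ^ (n + 1) - 1) / ((n : ℂ) + 1) := by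
  have hn : (n : ℂ) + 1 ≠ 0 := by exact_mod_cast n.succ_ne_zero
  have h := intervalIntegral.integral_eq_sub_of_hasDerivAt (a := 0) (b := x)
    (f := fun θ => uc θ ^ (n + 1) / ((n : ℂ) + 1)) (f' := fun θ => Complex.I * uc θ * uc θ ^ n)
    (fun θ _ => by
      have := ((hasDerivAt_uc θ).pow (n + 1)).div_const ((n : ℂ) + 1)
      have e : Complex.I * uc θ * uc θ ^ n =
          ((n + 1 : ℕ) : ℂ) * uc θ ^ (n + 1 - 1) * (Complex.I * uc θ) / ((n : ℂ) + 1) := by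
        rw [Nat.add_sub_cancel]
        push_cast
        field_simp
      rw [e]
      exact this)
    ((by have := continuous_uc; fun_prop : Continuous fun θ =>
      Complex.I * uc θ * uc θ ^ n).intervalIntegrable _ _)
  rw [h]
  simp [uc, sub_div]

/-- Fatou's theorem for power series with square-summable coefficients. -/
lemma ae_tendsto_radial {h : ℂ → ℂ} {f : ℝ → ℂ} {a : ℕ → ℂ} (ha : Summable fun n => ‖a n‖ ^ 2)
    (hs : ∀ z ∈ unitDisk, HasSum (fun n => a n * z ^ n) (h z)) (hf : MemLp f 2 bMeasure)
    (hw : ∀ φ : ℝ → ℂ, MemLp φ 2 bMeasure →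
      HasSum (fun n => a n * ∫ θ, φ θ * uc θ ^ n ∂bMeasure) (∫ θ, φ θ * f θ ∂bMeasure)) :
    ∀ᵐ θ ∂bMeasure, Tendsto (fun r : ℝ => h (r * uc θ)) (nhdsWithin 1 (Iio 1)) (nhds (f θ)) := by
  set F : ℕ → ℂ → ℂ := fun n w => a n / ((n : ℂ) + 1) * w ^ (n + 1) with hF
  have hu := summable_norm_div_succ ha
  have hFb : ∀ n w, w ∈ Metric.closedBall (0 : ℂ) 1 → ‖F n w‖ ≤ ‖a n‖ / ((n : ℝ) + 1) := by
    intro n w hw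
    have h1 : ‖(n : ℂ) + 1‖ = (n : ℝ) + 1 := by
      have := Complex.norm_natCast (n + 1)
      push_cast at this
      exact this
    simp only [hF, norm_mul, norm_div, norm_pow, h1]
    exact mul_le_of_le_one_right (by positivity) (pow_le_one₀ (norm_nonneg _) (by simpa using hw))
  have hFb' : ∀ n w, w ∈ Metric.ball (0 : ℂ) 1 → ‖F n w‖ ≤ ‖a n‖ / ((n : ℝ) + 1) :=
    fun n w hw => hFb n w (Metric.ball_subset_closedBall hw)
  have hFd : ∀ n, Differentiable ℂ (F n) := fun n => by fun_prop
  set H : ℂ → ℂ := fun w => ∑' n, F n w with hH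
  have hHd : DiffContOnCl ℂ H (Metric.ball 0 1) := by
    refine ⟨Complex.differentiableOn_tsum_of_summable_norm hu
      (fun n => (hFd n).differentiableOn) Metric.isOpen_ball hFb', ?_⟩
    rw [closure_ball (0 : ℂ) one_ne_zero]
    exact continuousOn_tsum (fun n => (hFd n).continuous.continuousOn) hu hFb
  have hderiv : ∀ z ∈ unitDisk, deriv H z = h z := by
    intro z hz
    have h1 := Complex.hasSum_deriv_of_summable_norm hu
      (fun n => (hFd n).differentiableOn) Metric.isOpen_ball hFb' hz
    refine h1.unique ?_
    convert! hs z hz using 2 with n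
    have hn : (n : ℂ) + 1 ≠ 0 := by exact_mod_cast n.succ_ne_zero
    simp only [hF]
    rw [deriv_const_mul _ (by fun_prop), deriv_pow_field]
    push_cast
    field_simp
  have hFs : ∀ θ, HasSum (fun n => F n (uc θ)) (H (uc θ)) := fun θ =>
    (Summable.of_norm_bounded hu fun n => hFb n _ (by simp [norm_uc])).hasSum
  have hprim : ∀ x ∈ Set.Icc 0 (2 * Real.pi),
      ∫ θ in (0 : ℝ)..x, Complex.I * uc θ * f θ = H (uc x) - H (uc 0) := by
    intro x hx
    set φ : ℝ → ℂ := (Set.Ioc 0 x).indicator fun θ => Complex.I * uc θ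
    have hφ : MemLp φ 2 bMeasure :=
      (memLp_of_continuous (continuous_const.mul continuous_uc) 2).indicator measurableSet_Ioc
    have hφi : ∀ g : ℝ → ℂ, ∫ θ, φ θ * g θ ∂bMeasure =
        ∫ θ in (0 : ℝ)..x, Complex.I * uc θ * g θ := by
      intro g
      have h1 : (fun θ => φ θ * g θ) =
          (Set.Ioc 0 x).indicator fun θ => Complex.I * uc θ * g θ := by
        ext θ
        simp only [φ, Set.indicator_mul_left]
      rw [h1, integral_indicator measurableSet_Ioc, bMeasure,
        Measure.restrict_restrict measurableSet_Ioc, Set.inter_eq_left.2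
          (Set.Ioc_subset_Ioc_right hx.2), intervalIntegral.integral_of_le hx.1]
    have h2 := hw φ hφ
    simp_rw [hφi, integral_uc_pow_Ioc] at h2
    refine h2.unique ?_
    convert! (hFs x).sub (hFs 0) using 2 with n
    simp [hF, uc]
    ring
  have hinteg : IntervalIntegrable (fun θ => Complex.I * uc θ * f θ) volume 0 (2 * Real.pi) := by
    rw [intervalIntegrable_iff_integrableOn_Ioc_of_le Real.two_pi_pos.le]
    exact (memLp_of_continuous (continuous_const.mul continuous_uc) 2).integrable_mul hf
  have hne : ∀ᵐ x : ℝ, x ≠ 2 * Real.pi := by simp [ae_iff, measure_singleton]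
  rw [bMeasure, ae_restrict_iff' measurableSet_Ioc]
  filter_upwards [hinteg.ae_hasDerivAt_integral, hne] with x hx hx2 hxm
  have hxo : x ∈ Set.Ioo 0 (2 * Real.pi) := ⟨hxm.1, lt_of_le_of_ne hxm.2 hx2⟩
  rw [uIcc_of_le Real.two_pi_pos.le] at hx
  have h1 := hx ⟨hxo.1.le, hxo.2.le⟩ 0 ⟨le_rfl, Real.two_pi_pos.le⟩
  have h2 : HasDerivAt (fun θ => H (uc θ)) (Complex.I * uc x * f x) x := by
    refine (h1.add_const (H (uc 0))).congr_of_eventuallyEq ?_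
    filter_upwards [Ioo_mem_nhds hxo.1 hxo.2] with y hy
    rw [hprim y ⟨hy.1.le, hy.2.le⟩]
    ring
  refine (tendsto_deriv_radial hHd h2).congr' ?_
  filter_upwards [Ioo_mem_nhdsLT (zero_lt_one (α := ℝ))] with r hr
  exact hderiv _ (mul_uc_mem_unitDisk hr.1.le hr.2 x)

/-- Boundary values of `H²` functions: the radial limits exist almost everywhere, are
square-integrable, and have the Taylor coefficients as Fourier coefficients. -/
lemma MemH2.exists_boundary {h : ℂ → ℂ} (hh : MemH2 h) :
    ∃ a : ℕ → ℂ, (∀ z ∈ unitDisk, HasSum (fun n => a n * z ^ n) (h z)) ∧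
      MemLp (bdry h) 2 bMeasure ∧
      (∀ᵐ θ ∂bMeasure, Tendsto (fun r : ℝ => h (r * uc θ)) (nhdsWithin 1 (Iio 1))
        (nhds (bdry h θ))) ∧
      ∀ φ : ℝ → ℂ, MemLp φ 2 bMeasure →
        HasSum (fun n => a n * ∫ θ, φ θ * uc θ ^ n ∂bMeasure) (∫ θ, φ θ * bdry h θ ∂bMeasure) := by
  obtain ⟨a, ha, hs⟩ := hh.exists_coeff
  obtain ⟨f, hf, hw⟩ := exists_memLp_hasSum_integral ha
  have ht := ae_tendsto_radial ha hs hf hw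
  have he : bdry h =ᵐ[bMeasure] f := by
    filter_upwards [ht] with θ hθ using hθ.limUnder_eq
  refine ⟨a, hs, hf.ae_eq he.symm, ?_, fun φ hφ => ?_⟩
  · filter_upwards [ht, he] with θ h1 h2
    rwa [h2]
  · convert! hw φ hφ using 1
    refine integral_congr_ae ?_
    filter_upwards [he] with θ h2
    rw [h2]

lemma one_sub_mem_slitPlane {z : ℂ} (hz : z ∈ unitDisk) : 1 - z ∈ slitPlane := by
  rw [sub_eq_add_neg]
  exact Complex.mem_slitPlane_of_norm_lt_one (by simpa [unitDisk] using hz)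

lemma one_sub_uc_mem_slitPlane {θ : ℝ} (hθ : θ ∈ Ioo 0 (2 * Real.pi)) : 1 - uc θ ∈ slitPlane := by
  left
  have h1 : (uc θ).re = Real.cos θ := by simp [uc, Complex.exp_ofReal_mul_I_re]
  have h2 : Real.cos θ ≠ 1 := fun h =>
    hθ.1.ne' ((Real.cos_eq_one_iff_of_lt_of_lt (by linarith [hθ.1, Real.pi_pos]) hθ.2).1 h)
  have h3 := lt_of_le_of_ne (Real.cos_le_one θ) h2
  simp only [Complex.sub_re, Complex.one_re, h1]
  linarith

lemma differentiableOn_one_sub_cpow (γ : ℂ) :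
    DifferentiableOn ℂ (fun z => (1 - z) ^ γ) unitDisk := fun _ hz =>
  ((differentiableAt_id.const_sub 1).cpow_const
    (one_sub_mem_slitPlane hz)).differentiableWithinAt

lemma ae_bMeasure_of_Ioo {P : ℝ → Prop} (h : ∀ θ ∈ Ioo 0 (2 * Real.pi), P θ) :
    ∀ᵐ θ ∂bMeasure, P θ := by
  rw [bMeasure, ← restrict_Ioo_eq_restrict_Ioc]
  exact (ae_restrict_iff' measurableSet_Ioo).2 (Eventually.of_forall h)

lemma tendsto_radial_of_continuousAt {f : ℂ → ℂ} {w : ℂ} (hf : ContinuousAt f w) :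
    Tendsto (fun r : ℝ => f (r * w)) (nhdsWithin 1 (Iio 1)) (nhds (f w)) := by
  have h1 : Tendsto (fun r : ℝ => (r : ℂ) * w) (nhds 1) (nhds w) := by
    have : Continuous fun r : ℝ => (r : ℂ) * w := by fun_prop
    simpa using this.tendsto 1
  exact hf.tendsto.comp (h1.mono_left nhdsWithin_le_nhds)

lemma tendsto_one_sub_cpow_radial (γ : ℂ) {θ : ℝ} (hθ : θ ∈ Ioo 0 (2 * Real.pi)) :
    Tendsto (fun r : ℝ => (1 - (r : ℂ) * uc θ) ^ γ) (nhdsWithin 1 (Iio 1))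
      (nhds ((1 - uc θ) ^ γ)) :=
  tendsto_radial_of_continuousAt (f := fun z => (1 - z) ^ γ)
    ((continuousAt_const.sub continuousAt_id).cpow continuousAt_const
      (one_sub_uc_mem_slitPlane hθ))

lemma eventually_mul_uc_mem_unitDisk (θ : ℝ) :
    ∀ᶠ r : ℝ in nhdsWithin 1 (Iio 1), (r : ℂ) * uc θ ∈ unitDisk := by
  filter_upwards [Ioo_mem_nhdsLT (zero_lt_one (α := ℝ))] with r hr
  exact mul_uc_mem_unitDisk hr.1.le hr.2 θ

lemma bdry_one_sub_cpow (γ : ℂ) {θ : ℝ} (hθ : θ ∈ Ioo 0 (2 * Real.pi)) :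
    bdry (fun z => (1 - z) ^ γ) θ = (1 - uc θ) ^ γ :=
  (tendsto_one_sub_cpow_radial γ hθ).limUnder_eq

lemma norm_one_sub_le {z : ℂ} (hz : z ∈ unitDisk) : ‖1 - z‖ ≤ 2 := by
  have h1 : ‖z‖ < 1 := by simpa [unitDisk] using hz
  have h2 := norm_sub_le (1 : ℂ) z
  rw [norm_one] at h2
  linarith

lemma norm_one_sub_cpow_le {γ : ℝ} (hγ : 0 ≤ γ) {z : ℂ} (hz : z ∈ unitDisk) :
    ‖(1 - z) ^ (γ : ℂ)‖ ≤ 2 ^ γ := by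
  rw [Complex.norm_cpow_real]
  exact Real.rpow_le_rpow (norm_nonneg _) (norm_one_sub_le hz) hγ

lemma conj_one_sub_uc (θ : ℝ) : (starRingEnd ℂ) (1 - uc θ) * uc θ = -(1 - uc θ) := by
  rw [map_sub, map_one, conj_uc, sub_mul, inv_mul_cancel₀ (uc_ne_zero θ)]
  ring

lemma symbQuot_mul_conj_cpow (α : ℝ) (k : ℕ) {θ : ℝ} (hθ : θ ∈ Ioo 0 (2 * Real.pi)) :
    symbQuot (fun z => (1 - z) ^ (α : ℂ)) θ *
        ((-uc θ) ^ k * (starRingEnd ℂ) ((1 - uc θ) ^ ((k - α : ℝ) : ℂ))) =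
      (1 - uc θ) ^ ((k - α : ℝ) : ℂ) := by
  have h0 : 1 - uc θ ≠ 0 := slitPlane_ne_zero (one_sub_uc_mem_slitPlane hθ)
  have h1 : (1 - uc θ) ^ (α : ℂ) ≠ 0 := by simp [Complex.cpow_eq_zero_iff, h0]
  have h2 : (1 - uc θ) ^ ((k - α : ℝ) : ℂ) = (1 - uc θ) ^ k / (1 - uc θ) ^ (α : ℂ) := by
    rw [Complex.ofReal_sub, Complex.cpow_sub _ _ h0, Complex.ofReal_natCast, Complex.cpow_natCast]
  have h3 : (starRingEnd ℂ) ((1 - uc θ) ^ (α : ℂ)) ≠ 0 := by simpa using h1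
  have h4 : (-uc θ) ^ k * (starRingEnd ℂ) (1 - uc θ) ^ k = (1 - uc θ) ^ k := by
    rw [← mul_pow]
    congr 1
    linear_combination -conj_one_sub_uc θ
  rw [symbQuot, bdry_one_sub_cpow _ hθ, h2, map_div₀, map_pow]
  generalize (starRingEnd ℂ) ((1 - uc θ) ^ (α : ℂ)) = A at *
  field_simp
  linear_combination h4

lemma symbQuot_mul_cpow (α : ℝ) (k : ℕ) {θ : ℝ} (hθ : θ ∈ Ioo 0 (2 * Real.pi)) :
    symbQuot (fun z => (1 - z) ^ (α : ℂ)) θ * (1 - uc θ) ^ ((α - k : ℝ) : ℂ) * (-uc θ) ^ k =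
      (starRingEnd ℂ) ((1 - uc θ) ^ ((α - k : ℝ) : ℂ)) := by
  have h0 : 1 - uc θ ≠ 0 := slitPlane_ne_zero (one_sub_uc_mem_slitPlane hθ)
  have h1 : (1 - uc θ) ^ (α : ℂ) ≠ 0 := by simp [Complex.cpow_eq_zero_iff, h0]
  have h2 : (1 - uc θ) ^ ((α - k : ℝ) : ℂ) = (1 - uc θ) ^ (α : ℂ) / (1 - uc θ) ^ k := by
    rw [Complex.ofReal_sub, Complex.cpow_sub _ _ h0, Complex.ofReal_natCast, Complex.cpow_natCast]
  have h3 : (starRingEnd ℂ) (1 - uc θ) ≠ 0 := (map_ne_zero _).2 h0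
  have h4 : (-uc θ) ^ k * (starRingEnd ℂ) (1 - uc θ) ^ k = (1 - uc θ) ^ k := by
    rw [← mul_pow]
    congr 1
    linear_combination -conj_one_sub_uc θ
  rw [symbQuot, bdry_one_sub_cpow _ hθ, h2, map_div₀, map_pow]
  generalize (starRingEnd ℂ) ((1 - uc θ) ^ (α : ℂ)) = A at *
  generalize (starRingEnd ℂ) (1 - uc θ) = B at *
  field_simp
  linear_combination A * h4

lemma memLp_symbQuot_mul (α : ℝ) {f : ℝ → ℂ} (hf : MemLp f 2 bMeasure) :
    MemLp (fun θ => symbQuot (fun z => (1 - z) ^ (α : ℂ)) θ * f θ) 2 bMeasure := by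
  have hm : Measurable fun θ => (1 - uc θ) ^ (α : ℂ) :=
    (measurable_const.sub continuous_uc.measurable).pow_const _
  have hm2 : AEStronglyMeasurable (symbQuot fun z => (1 - z) ^ (α : ℂ)) bMeasure := by
    refine AEStronglyMeasurable.congr (f := fun θ =>
      (starRingEnd ℂ) ((1 - uc θ) ^ (α : ℂ)) / (1 - uc θ) ^ (α : ℂ)) ?_ ?_
    · exact ((Complex.continuous_conj.measurable.comp hm).div hm).aestronglyMeasurable
    · refine ae_bMeasure_of_Ioo fun θ hθ => ?_
      rw [symbQuot, bdry_one_sub_cpow _ hθ]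
  refine hf.of_le (hm2.mul hf.1) (Eventually.of_forall fun θ => ?_)
  rw [norm_mul, symbQuot, norm_div, RCLike.norm_conj]
  exact mul_le_of_le_one_left (norm_nonneg _) (div_self_le_one _)

lemma hasSum_szProj {u : ℝ → ℂ} (hu : Integrable u bMeasure) {z : ℂ} (hz : z ∈ unitDisk) :
    HasSum (fun k : ℕ => ((1 / (2 * (Real.pi : ℂ))) * ∫ θ, u θ * uc θ ^ (-(k : ℤ)) ∂bMeasure) *
      z ^ k) (szProj u z) := by
  have hz1 : ‖z‖ < 1 := by simpa [unitDisk] using hz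
  have hn : ∀ (k : ℕ) θ, ‖u θ * (z * (uc θ)⁻¹) ^ k‖ = ‖z‖ ^ k * ‖u θ‖ := fun k θ => by
    simp [norm_uc, mul_comm]
  have h2 := hasSum_integral_of_summable_integral_norm (μ := bMeasure)
    (F := fun (k : ℕ) θ => u θ * (z * (uc θ)⁻¹) ^ k)
    (fun k => hu.mul_bdd (c := ‖z‖ ^ k)
      ((continuous_const.mul (continuous_uc.inv₀ uc_ne_zero)).pow k).aestronglyMeasurable
      (Eventually.of_forall fun θ => by simp [norm_uc])) (by
      simp_rw [hn, integral_const_mul]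
      exact (summable_geometric_of_lt_one (norm_nonneg z) hz1).mul_right _)
  have h3 : ∀ θ, ∑' k : ℕ, u θ * (z * (uc θ)⁻¹) ^ k = u θ * (1 - z * (uc θ)⁻¹)⁻¹ := fun θ => by
    rw [tsum_mul_left, tsum_geometric_of_norm_lt_one (by simpa [norm_uc] using hz1)]
  simp_rw [h3] at h2
  rw [szProj, intervalIntegral_eq_bMeasure]
  convert! h2.mul_left (1 / (2 * (Real.pi : ℂ))) using 2 with k
  rw [mul_assoc, ← integral_mul_const]
  congr 2
  ext θ
  rw [mul_pow, zpow_neg, zpow_natCast, inv_pow]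
  ring

/-- The Szegő projection of `u` vanishes iff all the nonnegative Fourier coefficients do. -/
lemma szProj_eq_zero_iff {u : ℝ → ℂ} (hu : Integrable u bMeasure) :
    (∀ z ∈ unitDisk, szProj u z = 0) ↔
      ∀ k : ℕ, ∫ θ, u θ * uc θ ^ (-(k : ℤ)) ∂bMeasure = 0 := by
  constructor
  · intro h k
    have h1 := integral_circle_coeff (h := fun _ => 0) (fun z hz => by
      simpa [h z hz] using hasSum_szProj hu hz) (r := 1 / 2) (by norm_num) (by norm_num) k
    have hp : (Real.pi : ℂ) ≠ 0 := Complex.ofReal_ne_zero.2 Real.pi_ne_zero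
    simpa [hp] using h1
  · intro h z hz
    have h1 := hasSum_szProj hu hz
    simp only [h, mul_zero, zero_mul] at h1
    exact h1.unique hasSum_zero

lemma MemH2.mul_bounded {h m : ℂ → ℂ} (hh : MemH2 h) (hm : DifferentiableOn ℂ m unitDisk) {K : ℝ}
    (hK : ∀ z ∈ unitDisk, ‖m z‖ ≤ K) : MemH2 fun z => m z * h z := by
  obtain ⟨hd, C, hC⟩ := hh
  refine ⟨hm.mul hd, K ^ 2 * C, fun r hr => ?_⟩
  have hc := continuous_comp_mul_uc hd hr.1 hr.2
  have hc2 := continuous_comp_mul_uc hm hr.1 hr.2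
  refine le_trans ?_ (mul_le_mul_of_nonneg_left (hC r hr) (sq_nonneg K))
  rw [← intervalIntegral.integral_const_mul]
  refine intervalIntegral.integral_mono_on Real.two_pi_pos.le
    ((hc2.mul hc).norm.pow 2 |>.intervalIntegrable _ _)
    ((continuous_const.mul (hc.norm.pow 2)).intervalIntegrable _ _) fun θ _ => ?_
  rw [norm_mul, mul_pow]
  have := hK _ (mul_uc_mem_unitDisk hr.1 hr.2 θ)
  gcongr

lemma memH2_one : MemH2 fun _ => 1 :=
  ⟨differentiableOn_const _, 2 * Real.pi, fun r _ => by simp⟩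

lemma MemH2.congr {f h : ℂ → ℂ} (hf : MemH2 f) (he : ∀ z ∈ unitDisk, h z = f z) : MemH2 h := by
  obtain ⟨hd, C, hC⟩ := hf
  refine ⟨hd.congr he, C, fun r hr => ?_⟩
  simp_rw [he _ (mul_uc_mem_unitDisk hr.1 hr.2 _)]
  exact hC r hr

lemma min_le_norm_one_sub_uc {θ : ℝ} (hθ : θ ∈ Ioo 0 (2 * Real.pi)) :
    2 / Real.pi * min θ (2 * Real.pi - θ) ≤ ‖1 - uc θ‖ := by
  have h1 : ‖1 - uc θ‖ = 2 * Real.sin (θ / 2) := by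
    rw [norm_sub_rev, uc, mul_comm, Complex.norm_exp_I_mul_ofReal_sub_one, norm_mul,
      Real.norm_eq_abs, Real.norm_eq_abs, abs_two, abs_of_nonneg]
    exact Real.sin_nonneg_of_nonneg_of_le_pi (by linarith [hθ.1]) (by linarith [hθ.2])
  have hp : 0 < 2 / Real.pi := div_pos two_pos Real.pi_pos
  rw [h1]
  rcases le_total θ Real.pi with h | h
  · have h2 := Real.mul_le_sin (x := θ / 2) (by linarith [hθ.1]) (by linarith)
    have h3 := mul_le_mul_of_nonneg_left (min_le_left θ (2 * Real.pi - θ)) hp.le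
    linarith
  · have h2 := Real.mul_le_sin (x := Real.pi - θ / 2) (by linarith [hθ.2]) (by linarith)
    rw [Real.sin_pi_sub] at h2
    have h3 := mul_le_mul_of_nonneg_left (min_le_right θ (2 * Real.pi - θ)) hp.le
    linarith

lemma norm_one_sub_uc_le_two_mul {r : ℝ} (hr : 0 ≤ r) (hr1 : r < 1) (θ : ℝ) :
    ‖1 - uc θ‖ ≤ 2 * ‖1 - r * uc θ‖ := by
  have h1 : ‖(r : ℂ) * uc θ‖ = r := by simp [norm_uc, abs_of_nonneg hr]
  have h2 : ‖(r : ℂ) * uc θ - uc θ‖ = 1 - r := by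
    have : (r : ℂ) * uc θ - uc θ = -(((1 - r : ℝ) : ℂ) * uc θ) := by push_cast; ring
    rw [this, norm_neg, norm_mul, norm_uc, Complex.norm_real, Real.norm_eq_abs,
      abs_of_pos (by linarith), mul_one]
  have h3 := norm_sub_norm_le (1 : ℂ) (r * uc θ)
  have h4 := norm_add_le (1 - r * uc θ) (r * uc θ - uc θ)
  rw [norm_one, h1] at h3
  rw [h2, sub_add_sub_cancel] at h4
  linarith

lemma memH2_one_sub_cpow {β : ℝ} (hβ : -(1 / 2 : ℝ) < β) : MemH2 fun z => (1 - z) ^ (β : ℂ) := by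
  rcases le_or_gt 0 β with h0 | h0
  · simpa using memH2_one.mul_bounded (differentiableOn_one_sub_cpow β)
      fun z hz => norm_one_sub_cpow_le h0 hz
  set c : ℝ := Real.pi⁻¹
  have hc : 0 < c := inv_pos.2 Real.pi_pos
  set D : ℝ → ℝ := fun θ => c ^ (2 * β) * (θ ^ (2 * β) + (2 * Real.pi - θ) ^ (2 * β)) with hD
  have h1 : IntervalIntegrable (fun θ : ℝ => θ ^ (2 * β)) volume 0 (2 * Real.pi) :=
    intervalIntegral.intervalIntegrable_rpow' (by linarith)
  have hDi : IntervalIntegrable D volume 0 (2 * Real.pi) := by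
    refine (h1.add ?_).const_mul _
    simpa using (h1.comp_sub_left (2 * Real.pi)).symm
  refine ⟨differentiableOn_one_sub_cpow β, ∫ θ in (0 : ℝ)..(2 * Real.pi), D θ, fun r hr => ?_⟩
  refine intervalIntegral.integral_mono_on_of_le_Ioo Real.two_pi_pos.le
    ((continuous_comp_mul_uc (differentiableOn_one_sub_cpow β) hr.1 hr.2).norm.pow 2
      |>.intervalIntegrable _ _) hDi fun θ hθ => ?_
  have hθ2 : 0 < 2 * Real.pi - θ := by linarith [hθ.2]
  have hm : 0 < min θ (2 * Real.pi - θ) := lt_min hθ.1 hθ2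
  have h2 : c * min θ (2 * Real.pi - θ) ≤ ‖1 - r * uc θ‖ := by
    have := (min_le_norm_one_sub_uc hθ).trans (norm_one_sub_uc_le_two_mul hr.1 hr.2 θ)
    have e : 2 / Real.pi * min θ (2 * Real.pi - θ) = 2 * (c * min θ (2 * Real.pi - θ)) := by
      simp only [c]; ring
    linarith
  rw [Complex.norm_cpow_real, ← Real.rpow_natCast, ← Real.rpow_mul (norm_nonneg _)]
  rw [show β * ((2 : ℕ) : ℝ) = 2 * β by push_cast; ring]
  refine (Real.rpow_le_rpow_of_nonpos (by positivity) h2 (by linarith)).trans ?_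
  rw [Real.mul_rpow hc.le hm.le]
  refine mul_le_mul_of_nonneg_left ?_ (by positivity)
  have p1 := Real.rpow_nonneg hθ.1.le (2 * β)
  have p2 := Real.rpow_nonneg hθ2.le (2 * β)
  rcases min_choice θ (2 * Real.pi - θ) with h | h <;> rw [h] <;> linarith

lemma MemH2.integral_mul_bdry_eq_zero {f : ℂ → ℂ} (hf : MemH2 f) {φ : ℝ → ℂ}
    (hφ : MemLp φ 2 bMeasure) (h0 : ∀ n : ℕ, ∫ θ, φ θ * uc θ ^ n ∂bMeasure = 0) :
    ∫ θ, φ θ * bdry f θ ∂bMeasure = 0 := by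
  obtain ⟨a, -, -, -, ha⟩ := hf.exists_boundary
  have h1 := ha φ hφ
  simp only [h0, mul_zero] at h1
  exact h1.unique hasSum_zero

/-- An `H²` function whose boundary Fourier coefficients of order `≥ n` vanish is a polynomial. -/
lemma MemH2.exists_polynomial {f : ℂ → ℂ} (hf : MemH2 f) {n : ℕ}
    (h0 : ∀ k : ℕ, n ≤ k → ∫ θ, uc θ ^ (-(k : ℤ)) * bdry f θ ∂bMeasure = 0) :
    ∃ q : Polynomial ℂ, q.degree < n ∧ ∀ z ∈ unitDisk, f z = q.eval z := by
  obtain ⟨a, hs, -, -, ha⟩ := hf.exists_boundary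
  have hp : (Real.pi : ℂ) ≠ 0 := Complex.ofReal_ne_zero.2 Real.pi_ne_zero
  have hak : ∀ k : ℕ, n ≤ k → a k = 0 := by
    intro k hk
    have h1 := ha _ (memLp_of_continuous (continuous_uc_zpow (-(k : ℤ))) 2)
    rw [h0 k hk] at h1
    have h2 : ∀ m : ℕ, a m * ∫ θ, uc θ ^ (-(k : ℤ)) * uc θ ^ m ∂bMeasure =
        if m = k then a k * (2 * (Real.pi : ℂ)) else 0 := by
      intro m
      have h3 : ∀ θ, uc θ ^ (-(k : ℤ)) * uc θ ^ m = uc θ ^ ((m : ℤ) - k) := fun θ => by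
        rw [sub_eq_neg_add, zpow_add₀ (uc_ne_zero θ), zpow_natCast]
      simp_rw [h3]
      rw [integral_uc_zpow]
      by_cases hmk : m = k
      · subst hmk; simp
      · rw [if_neg (by omega), if_neg hmk, mul_zero]
    simp_rw [h2] at h1
    have h3 := h1.unique (hasSum_ite_eq k _)
    simpa [hp] using h3.symm
  refine ⟨∑ i : Fin n, Polynomial.C (a i) * Polynomial.X ^ (i : ℕ),
    Polynomial.degree_sum_fin_lt fun i : Fin n => a i, fun z hz => ?_⟩
  have h4 : HasSum (fun k => a k * z ^ k) (∑ k ∈ Finset.range n, a k * z ^ k) :=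
    hasSum_sum_of_ne_finset_zero fun k hk => by
      rw [hak k (by simpa using hk), zero_mul]
  rw [(hs z hz).unique h4, Polynomial.eval_finsetSum, Finset.sum_range]
  simp

lemma norm_one_sub_uc_le {θ : ℝ} (hθ : 0 ≤ θ) : ‖1 - uc θ‖ ≤ θ := by
  rw [norm_sub_rev, uc, mul_comm]
  simpa [abs_of_nonneg hθ] using Real.norm_exp_I_mul_ofReal_sub_one_le (x := θ)

lemma eval_one_eq_zero_of_memLp {γ : ℝ} (hγ : 1 / 2 ≤ γ) {q : Polynomial ℂ} {f : ℝ → ℂ}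
    (hf : MemLp f 2 bMeasure)
    (he : ∀ θ ∈ Ioo 0 (2 * Real.pi), (1 - uc θ) ^ (γ : ℂ) * f θ = q.eval (uc θ)) :
    q.eval 1 = 0 := by
  by_contra hq
  have hpos : 0 < ‖q.eval 1‖ := norm_pos_iff.2 hq
  set c := ‖q.eval 1‖ / 2 with hc
  have hcont : Continuous fun θ => ‖q.eval (uc θ)‖ := (q.continuous.comp continuous_uc).norm
  have h1 : ∀ᶠ θ in nhds (0 : ℝ), c < ‖q.eval (uc θ)‖ := by
    refine hcont.continuousAt.eventually_const_lt ?_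
    have : uc 0 = 1 := by simp [uc]
    simp only [this]
    linarith
  obtain ⟨δ, hδ, hδc⟩ := Metric.eventually_nhds_iff.1 h1
  set ε := min (δ / 2) 1
  have hε : 0 < ε := lt_min (by linarith) one_pos
  have hε2 : ε < 2 * Real.pi := (min_le_right _ _).trans_lt (by linarith [Real.pi_gt_three])
  have h2 : IntegrableOn (fun θ => ‖f θ‖ ^ 2) (Ioc 0 ε) := by
    have := hf.integrable_norm_pow two_ne_zero
    exact IntegrableOn.mono_set this (Ioc_subset_Ioc_right hε2.le)
  have h3 : IntegrableOn (fun θ : ℝ => θ⁻¹) (Ioc 0 ε) := by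
    refine Integrable.mono' (h2.const_mul (c ^ 2)⁻¹) measurable_inv.aestronglyMeasurable ?_
    refine (ae_restrict_iff' measurableSet_Ioc).2 (Eventually.of_forall fun θ hθ => ?_)
    have hθ' : θ ∈ Ioo 0 (2 * Real.pi) := ⟨hθ.1, hθ.2.trans_lt hε2⟩
    have hlt : c < ‖q.eval (uc θ)‖ := hδc (by
      rw [Real.dist_eq, sub_zero, abs_of_pos hθ.1]
      linarith [hθ.2.trans (min_le_left _ _)])
    rw [← he θ hθ', norm_mul, Complex.norm_cpow_real] at hlt
    have hle := norm_one_sub_uc_le hθ.1.le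
    have hθ1 : θ ≤ 1 := hθ.2.trans (min_le_right _ _)
    have h4 : (‖1 - uc θ‖ ^ γ) ^ 2 ≤ θ := by
      rw [← Real.rpow_natCast, ← Real.rpow_mul (norm_nonneg _)]
      have h5 := Real.rpow_le_rpow_of_exponent_ge'
        (norm_nonneg (1 - uc θ)) (hle.trans hθ1) zero_le_one
        (show (1 : ℝ) ≤ γ * ((2 : ℕ) : ℝ) by push_cast; linarith)
      rw [Real.rpow_one] at h5
      exact h5.trans hle
    have h6 : c ^ 2 ≤ θ * ‖f θ‖ ^ 2 := by
      have := pow_le_pow_left₀ (by positivity) hlt.le 2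
      rw [mul_pow] at this
      exact this.trans (mul_le_mul_of_nonneg_right h4 (sq_nonneg _))
    have hcpos : 0 < c ^ 2 := by positivity
    rw [Real.norm_eq_abs, abs_of_pos (inv_pos.2 hθ.1), inv_mul_eq_div, inv_eq_one_div,
      div_le_div_iff₀ hθ.1 hcpos]
    linarith
  have h7 := intervalIntegrable_inv_iff.1
    ((intervalIntegrable_iff_integrableOn_Ioc_of_le hε.le).2 h3)
  rcases h7 with h | h
  · exact hε.ne h
  · exact h left_mem_uIcc

/-- Functions in the kernel are of the form `(1 - z) ^ (α - n) * p` with `p` of degree `< n`. -/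
lemma exists_polynomial_of_mem_toeplitzKer {α : ℝ} {n : ℕ} (hα : α ≤ n + 1 / 2) {h : ℂ → ℂ}
    (hh : h ∈ toeplitzKer (symbQuot fun z => (1 - z) ^ (α : ℂ))) :
    ∃ p : Polynomial ℂ, p.degree < (n : WithBot ℕ) ∧
      ∀ z ∈ unitDisk, h z = (1 - z) ^ ((α - n : ℝ) : ℂ) * p.eval z := by
  obtain ⟨hH, hker⟩ := hh
  obtain ⟨-, -, hL, hlim, -⟩ := hH.exists_boundary
  set γ : ℝ := ((n + 1 : ℕ) : ℝ) - α with hγd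
  have hγ : 1 / 2 ≤ γ := by rw [hγd]; push_cast; linarith
  set u : ℝ → ℂ := fun θ => symbQuot (fun z => (1 - z) ^ (α : ℂ)) θ * bdry h θ with hu
  have huL : MemLp u 2 bMeasure := memLp_symbQuot_mul α hL
  have hu0 := (szProj_eq_zero_iff (huL.integrable one_le_two)).1 hker
  have hm := differentiableOn_one_sub_cpow (γ : ℂ)
  have hmb : ∀ z ∈ unitDisk, ‖(1 - z) ^ (γ : ℂ)‖ ≤ 2 ^ γ := fun z hz =>
    norm_one_sub_cpow_le (by linarith) hz
  have hF := hH.mul_bounded hm hmb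
  have hG : MemH2 fun z => (1 - z) ^ (γ : ℂ) := memH2_one_sub_cpow (by linarith)
  have hFb : ∀ᵐ θ ∂bMeasure, bdry (fun z => (1 - z) ^ (γ : ℂ) * h z) θ =
      (1 - uc θ) ^ (γ : ℂ) * bdry h θ := by
    filter_upwards [hlim, ae_bMeasure_of_Ioo (P := fun θ => θ ∈ Ioo 0 (2 * Real.pi))
      fun _ h => h] with θ hθ hθ2
    exact ((tendsto_one_sub_cpow_radial γ hθ2).mul hθ).limUnder_eq
  have hcoeff : ∀ k : ℕ, n + 1 ≤ k →
      ∫ θ, uc θ ^ (-(k : ℤ)) * bdry (fun z => (1 - z) ^ (γ : ℂ) * h z) θ ∂bMeasure = 0 := by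
    intro k hk
    obtain ⟨m, rfl⟩ := Nat.exists_eq_add_of_le hk
    have h1 : ∫ θ, ((starRingEnd ℂ) (u θ) * uc θ ^ m) * bdry (fun z => (1 - z) ^ (γ : ℂ)) θ
        ∂bMeasure = 0 := by
      refine hG.integral_mul_bdry_eq_zero ?_ fun j => ?_
      · refine huL.star.of_le (huL.star.1.mul (continuous_uc.pow m).aestronglyMeasurable)
          (Eventually.of_forall fun θ => ?_)
        simp [norm_uc]
      · have h2 := congrArg (starRingEnd ℂ) (hu0 (m + j))
        rw [← integral_conj, map_zero] at h2
        rw [← h2]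
        congr 1
        ext θ
        rw [map_mul (starRingEnd ℂ) (u θ), zpow_neg, zpow_natCast, map_inv₀, map_pow,
          conj_uc, inv_pow, inv_inv,
          pow_add, mul_assoc]
    have h3 := congrArg (fun x => (-1) ^ (n + 1) * (starRingEnd ℂ) x) h1
    simp only [← integral_conj, map_zero, mul_zero] at h3
    rw [← integral_const_mul] at h3
    rw [← h3]
    refine integral_congr_ae ?_
    filter_upwards [hFb, ae_bMeasure_of_Ioo (P := fun θ => θ ∈ Ioo 0 (2 * Real.pi))
      fun _ h => h] with θ hθ hθ2
    rw [hθ, ← symbQuot_mul_conj_cpow α (n + 1) hθ2, bdry_one_sub_cpow _ hθ2, map_mul, map_mul,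
      Complex.conj_conj, map_pow, conj_uc, zpow_neg, zpow_natCast, pow_add _ (n + 1) m,
      neg_eq_neg_one_mul (uc θ), mul_pow]
    have := uc_ne_zero θ
    rw [inv_pow]
    simp only [hu, ← hγd]
    field_simp
  obtain ⟨q, hq, hqe⟩ := hF.exists_polynomial hcoeff
  have hq1 : q.eval 1 = 0 := by
    have hL2 : MemLp (fun θ => q.eval (uc θ) / (1 - uc θ) ^ (γ : ℂ)) 2 bMeasure := by
      refine (memLp_congr_ae ?_).1 hL
      filter_upwards [hlim, ae_bMeasure_of_Ioo (P := fun θ => θ ∈ Ioo 0 (2 * Real.pi))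
        fun _ h => h] with θ hθ hθ2
      have h1 := (tendsto_one_sub_cpow_radial γ hθ2).mul hθ
      have h2 := tendsto_radial_of_continuousAt (q.continuous.continuousAt (x := uc θ))
      have h3 : (1 - uc θ) ^ (γ : ℂ) ≠ 0 := by
        simp [Complex.cpow_eq_zero_iff, slitPlane_ne_zero (one_sub_uc_mem_slitPlane hθ2)]
      rw [eq_div_iff h3, mul_comm]
      refine tendsto_nhds_unique (h1.congr' ?_) h2
      filter_upwards [eventually_mul_uc_mem_unitDisk θ] with r hr using hqe _ hr
    refine eval_one_eq_zero_of_memLp hγ hL2 fun θ hθ => mul_div_cancel₀ _ ?_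
    simp [Complex.cpow_eq_zero_iff, slitPlane_ne_zero (one_sub_uc_mem_slitPlane hθ)]
  obtain ⟨p, rfl⟩ := Polynomial.dvd_iff_isRoot.2 hq1
  refine ⟨-p, ?_, fun z hz => ?_⟩
  · rw [Polynomial.degree_neg]
    rcases eq_or_ne p 0 with rfl | hp
    · simp
    · rw [Polynomial.degree_mul, Polynomial.degree_X_sub_C, Polynomial.degree_eq_natDegree hp] at hq
      rw [Polynomial.degree_eq_natDegree hp]
      norm_cast at hq ⊢
      omega
  · have h0 := slitPlane_ne_zero (one_sub_mem_slitPlane hz)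
    have h1 := hqe z hz
    have h2 : (1 - z) ^ ((α - n : ℝ) : ℂ) * (1 - z) ^ (γ : ℂ) = 1 - z := by
      rw [← Complex.cpow_add _ _ h0, ← Complex.ofReal_add,
        show α - n + γ = 1 by rw [hγd]; push_cast; ring]
      simp
    simp only [Polynomial.eval_mul, Polynomial.eval_sub, Polynomial.eval_X, Polynomial.eval_C,
      Polynomial.eval_neg] at h1 ⊢
    refine mul_left_cancel₀ h0 ?_
    linear_combination (1 - z) ^ ((α - n : ℝ) : ℂ) * h1 - h z * h2

lemma eval_eq_sum_fin {p : Polynomial ℂ} {n : ℕ} (hp : p.degree < (n : WithBot ℕ)) (z : ℂ) :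
    p.eval z = ∑ i : Fin n, p.coeff i * z ^ (i : ℕ) :=
  Polynomial.eval_eq_sum.trans (Polynomial.sum_fin (fun i a => a * z ^ i) (by simp) hp).symm

lemma mem_toeplitzKer_of_polynomial {α : ℝ} {n : ℕ} (hα : n - 1 / 2 < α) {h : ℂ → ℂ}
    {p : Polynomial ℂ} (hp : p.degree < (n : WithBot ℕ))
    (he : ∀ z ∈ unitDisk, h z = (1 - z) ^ ((α - n : ℝ) : ℂ) * p.eval z) :
    h ∈ toeplitzKer (symbQuot fun z => (1 - z) ^ (α : ℂ)) := by
  have hG : MemH2 fun z => (1 - z) ^ ((α - n : ℝ) : ℂ) := memH2_one_sub_cpow (by linarith)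
  obtain ⟨K, hK⟩ := (isCompact_closedBall (0 : ℂ) 1).exists_bound_of_continuousOn
    p.continuous.continuousOn
  have hH : MemH2 h := (hG.mul_bounded p.differentiable.differentiableOn fun z hz =>
    hK z (Metric.ball_subset_closedBall hz)).congr fun z hz => by rw [he z hz, mul_comm]
  obtain ⟨-, -, hL, -, -⟩ := hH.exists_boundary
  refine ⟨hH, (szProj_eq_zero_iff
    ((memLp_symbQuot_mul α hL).integrable one_le_two)).2 fun k => ?_⟩
  have hb : ∀ θ ∈ Ioo 0 (2 * Real.pi), bdry h θ =
      (1 - uc θ) ^ ((α - n : ℝ) : ℂ) * p.eval (uc θ) := by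
    intro θ hθ
    refine (((tendsto_one_sub_cpow_radial _ hθ).mul
      (tendsto_radial_of_continuousAt p.continuous.continuousAt)).congr' ?_).limUnder_eq
    filter_upwards [eventually_mul_uc_mem_unitDisk θ] with r hr using (he _ hr).symm
  have h1 : ∫ θ, ((-1) ^ n * (starRingEnd ℂ) (p.eval (uc θ)) * uc θ ^ (n + k)) *
      bdry (fun z => (1 - z) ^ ((α - n : ℝ) : ℂ)) θ ∂bMeasure = 0 := by
    refine hG.integral_mul_bdry_eq_zero (memLp_of_continuous ?_ 2) fun j => ?_
    · exact (continuous_const.mul (Complex.continuous_conj.comp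
        (p.continuous.comp continuous_uc))).mul (continuous_uc.pow _)
    · have h2 : ∀ θ, (-1) ^ n * (starRingEnd ℂ) (p.eval (uc θ)) * uc θ ^ (n + k) * uc θ ^ j =
          ∑ i : Fin n, ((-1) ^ n * (starRingEnd ℂ) (p.coeff i)) *
            uc θ ^ ((n + k + j : ℕ) - (i : ℕ) : ℤ) := by
        intro θ
        rw [eval_eq_sum_fin hp, map_sum, Finset.mul_sum, Finset.sum_mul, Finset.sum_mul]
        refine Finset.sum_congr rfl fun i _ => ?_
        rw [zpow_sub₀ (uc_ne_zero θ), map_mul, map_pow, conj_uc, zpow_natCast, zpow_natCast,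
          pow_add _ (n + k) j, inv_pow]
        ring
      simp_rw [h2]
      rw [integral_finsetSum]
      swap
      · exact fun i _ => memLp_one_iff_integrable.1 (memLp_of_continuous
          (continuous_const.mul (continuous_uc_zpow _)) 1)
      refine Finset.sum_eq_zero fun i _ => ?_
      have := i.2
      rw [integral_const_mul, integral_uc_zpow, if_neg (by omega), mul_zero]
  have h3 := congrArg (starRingEnd ℂ) h1
  rw [← integral_conj, map_zero] at h3
  rw [← h3]
  refine integral_congr_ae (ae_bMeasure_of_Ioo fun θ hθ => ?_)
  simp only
  rw [hb θ hθ, bdry_one_sub_cpow _ hθ, map_mul _ _ ((1 - uc θ) ^ ((α - n : ℝ) : ℂ)),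
    ← symbQuot_mul_cpow α n hθ, zpow_neg, zpow_natCast]
  simp only [map_mul, map_pow, conj_uc, map_neg, map_one, Complex.conj_conj]
  have h4 := uc_ne_zero θ
  have h5 : ((-1 : ℂ) ^ n) * (-1) ^ n = 1 := by rw [← mul_pow]; simp
  rw [neg_eq_neg_one_mul (uc θ), mul_pow, pow_add, inv_pow, inv_pow]
  field_simp
  linear_combination -(symbQuot (fun z => (1 - z) ^ (α : ℂ)) θ *
    (1 - uc θ) ^ ((α - n : ℝ) : ℂ) * p.eval (uc θ)) * h5

lemma hasDimOn_one_sub_cpow_mul (β : ℂ) (n : ℕ) :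
    HasDimOn {h : ℂ → ℂ | ∃ p : Polynomial ℂ, p.degree < (n : WithBot ℕ) ∧
      ∀ z ∈ unitDisk, h z = (1 - z) ^ β * Polynomial.eval z p} n := by
  refine ⟨fun j z => (1 - z) ^ β * z ^ (j : ℕ), fun j => ⟨Polynomial.X ^ (j : ℕ), ?_, by simp⟩,
    fun c hc => ?_, ?_⟩
  · rw [Polynomial.degree_X_pow]
    exact_mod_cast j.2
  · set p : Polynomial ℂ := ∑ i : Fin n, Polynomial.C (c i) * Polynomial.X ^ (i : ℕ) with hp
    have h1 : ∀ z ∈ unitDisk, p.eval z = 0 := by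
      intro z hz
      have h2 : (1 - z) ^ β ≠ 0 := by
        simp [Complex.cpow_eq_zero_iff, slitPlane_ne_zero (one_sub_mem_slitPlane hz)]
      refine mul_left_cancel₀ h2 ?_
      rw [mul_zero, ← hc z hz, hp, Polynomial.eval_finsetSum, Finset.mul_sum]
      refine Finset.sum_congr rfl fun i _ => ?_
      simp
      ring
    have h3 : p = 0 := by
      refine Polynomial.eq_zero_of_infinite_isRoot p
        (((infinite_of_mem_nhds (0 : ℂ)) (Metric.ball_mem_nhds 0 one_pos)).mono h1)
    ext i
    have h4 := congrArg (fun q => Polynomial.coeff q (i : ℕ)) h3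
    simpa [hp, Polynomial.finsetSum_coeff, Polynomial.coeff_C_mul, Polynomial.coeff_X_pow,
      Fin.val_inj] using h4
  · rintro h ⟨p, hp, he⟩
    refine ⟨fun j => p.coeff j, fun z hz => ?_⟩
    rw [he z hz, eval_eq_sum_fin hp, Finset.mul_sum]
    refine Finset.sum_congr rfl fun i _ => ?_
    ring

/-- Example.  For `α > −1/2` and `g(z) = (1−z)^α`: the kernel of
`T_{ḡ/g}` is trivial when `α ∈ (−1/2, 1/2]`, and for every positive integer `n` and
`α ∈ (n−1/2, n+1/2]` the kernel is `n`-dimensional and equals `(1−z)^{α−n} K_{zⁿ}`,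
the set of functions `(1−z)^{α−n} p(z)` with `p` a polynomial of degree at most `n−1`. -/
theorem kernel_of_one_sub_z_pow (α : ℝ) (hα : -(1/2 : ℝ) < α) :
    ((α ≤ 1/2) →
      ∀ h ∈ toeplitzKer (symbQuot (fun z => (1 - z) ^ (α : ℂ))),
        ∀ z ∈ unitDisk, h z = 0) ∧
    (∀ n : ℕ, 0 < n → ((n : ℝ) - 1/2 < α ∧ α ≤ (n : ℝ) + 1/2) →
      HasDimOn (toeplitzKer (symbQuot (fun z => (1 - z) ^ (α : ℂ)))) n ∧
      toeplitzKer (symbQuot (fun z => (1 - z) ^ (α : ℂ))) =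
        {h : ℂ → ℂ | ∃ p : Polynomial ℂ, p.degree < (n : WithBot ℕ) ∧
          ∀ z ∈ unitDisk, h z = (1 - z) ^ (((α - n : ℝ)) : ℂ) * Polynomial.eval z p}) := by
  refine ⟨fun hα' h hh z hz => ?_, fun n _ hn => ?_⟩
  · obtain ⟨p, hp, he⟩ := exists_polynomial_of_mem_toeplitzKer (n := 0) (by simpa using hα') hh
    have hp0 : p = 0 := by
      rw [← Polynomial.degree_eq_bot]
      simpa [Nat.WithBot.lt_zero_iff] using hp
    simp [he z hz, hp0]
  · have hset : toeplitzKer (symbQuot (fun z => (1 - z) ^ (α : ℂ))) =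
        {h : ℂ → ℂ | ∃ p : Polynomial ℂ, p.degree < (n : WithBot ℕ) ∧
          ∀ z ∈ unitDisk, h z = (1 - z) ^ (((α - n : ℝ)) : ℂ) * Polynomial.eval z p} := by
      ext h
      exact ⟨exists_polynomial_of_mem_toeplitzKer hn.2, fun ⟨p, hp, he⟩ =>
        mem_toeplitzKer_of_polynomial hn.1 hp he⟩
    refine ⟨?_, hset⟩
    rw [hset]
    exact hasDimOn_one_sub_cpow_mul _ n

end
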